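/- Let A be a closed polar subset of a domain D ⊆ ℂ and let f be holomorphic on D \ A. Let B ⊆ A be such that no point of B is an accumulation point of A (i.e., every point of B is isolated in A), and assume that f does not extend holomorphically to any point of B, i.e., for every b ∈ B there is no open neighborhood V ⊆ D of b and holomorphic g on V with g = f on V \ A. Then the set {(z, f(z)) : z ∈ D \ A} ∪ ((A \ B) × ℂ) is complete pluripolar in D × ℂ. -/

import Mathlib

open Set Metric MeasureTheory Filter Topology

noncomputable section

open Classical in
/-- The average of an `EReal`-valued function over the circle of center `z` and radius `r`;
it is `⊥` if the function equals `⊥` on a set of positive measure of the circle or if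
its (finite) values are not integrable over the circle. -/
def circleAvg (u : ℂ → EReal) (z : ℂ) (r : ℝ) : EReal :=
  if (IntervalIntegrable (fun θ : ℝ => (u (circleMap z r θ)).toReal) volume 0 (2 * Real.pi)
      ∧ ∀ᵐ θ ∂(volume.restrict (Set.Ioc (0:ℝ) (2 * Real.pi))), u (circleMap z r θ) ≠ ⊥)
  then (((∫ θ in (0:ℝ)..(2 * Real.pi), (u (circleMap z r θ)).toReal) / (2 * Real.pi) : ℝ) : EReal)
  else ⊥

/-- `u` is plurisubharmonic on a (typically open) set `Ω` of a complex vector space: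
it takes values in `[-∞, ∞)`, is upper semicontinuous on `Ω`, is not identically `-∞`
on any connected component of `Ω`, and its restriction to every complex line satisfies
the sub-mean value inequality on circles (whose closed discs lie in `Ω`). -/
def PSHOn {E : Type*} [NormedAddCommGroup E] [NormedSpace ℂ E]
    (u : E → EReal) (Ω : Set E) : Prop :=
  (∀ z ∈ Ω, u z ≠ ⊤) ∧
  UpperSemicontinuousOn u Ω ∧
  (∀ z ∈ Ω, ∃ w ∈ connectedComponentIn Ω z, u w ≠ ⊥) ∧
  ∀ a b : E, ∀ c : ℂ, ∀ r : ℝ, 0 < r →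
    (∀ l ∈ Metric.closedBall c r, a + l • b ∈ Ω) →
    u (a + c • b) ≤ circleAvg (fun l : ℂ => u (a + l • b)) c r

/-- In one complex variable, plurisubharmonic = subharmonic. -/
abbrev SubharmonicOn (u : ℂ → EReal) (Ω : Set ℂ) : Prop := PSHOn u Ω

/-- A set `P ⊆ ℂ` is polar if `P ⊆ {u = -∞}` for some subharmonic `u` on `ℂ`
(not identically `-∞`). -/
def PolarSet (P : Set ℂ) : Prop :=
  ∃ u : ℂ → EReal, SubharmonicOn u Set.univ ∧ ∀ z ∈ P, u z = ⊥

/-- `S` is pluripolar in `Ω`. -/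
def PluripolarIn {E : Type*} [NormedAddCommGroup E] [NormedSpace ℂ E]
    (S Ω : Set E) : Prop :=
  ∃ u : E → EReal, PSHOn u Ω ∧ ∀ z ∈ S, u z = ⊥

/-- `S` is complete pluripolar in `Ω`: `S` is exactly the `-∞`-set of some
plurisubharmonic function on `Ω`. -/
def CompletePluripolarIn {E : Type*} [NormedAddCommGroup E] [NormedSpace ℂ E]
    (S Ω : Set E) : Prop :=
  ∃ u : E → EReal, PSHOn u Ω ∧ ∀ z ∈ Ω, (u z = ⊥ ↔ z ∈ S)

/-- The pluripolar hull `S*_Ω` of `S` in `Ω`. -/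
def pluripolarHull {E : Type*} [NormedAddCommGroup E] [NormedSpace ℂ E]
    (S Ω : Set E) : Set E :=
  {z ∈ Ω | ∀ u : E → EReal, PSHOn u Ω → (∀ w ∈ S, u w = ⊥) → u z = ⊥}

/-- `S` is (pluri-)thin at `ζ`: either `ζ` is not a limit point of `S \ {ζ}`, or there is
a plurisubharmonic function on a neighborhood of `ζ` with
`limsup_{z → ζ, z ∈ S \ {ζ}} u z < u ζ`. -/
def PluriThinAt {E : Type*} [NormedAddCommGroup E] [NormedSpace ℂ E]
    (S : Set E) (ζ : E) : Prop :=
  ζ ∉ closure (S \ {ζ}) ∨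
  ∃ U : Set E, IsOpen U ∧ ζ ∈ U ∧ ∃ u : E → EReal, PSHOn u U ∧
    Filter.limsup u (nhdsWithin ζ (S \ {ζ})) < u ζ

/-- Thinness in `ℂ`. -/
abbrev ThinAt (S : Set ℂ) (ζ : ℂ) : Prop := PluriThinAt S ζ

/-- The relative extremal function (pluriharmonic measure) `ω(z, A, D)`:
`-sup { u(z) : u` psh on `D`, `u ≤ 0` on `D`, `u ≤ -1` on `A }`, where for points of `A`
not belonging to `D` the condition `u ≤ -1` is understood as
`limsup_{ζ → w, ζ ∈ D} u(ζ) ≤ -1` (for `w ∈ A ∩ D` and `u` upper semicontinuous the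
condition below is equivalent to `u w ≤ -1`). -/
def relExtremal {E : Type*} [NormedAddCommGroup E] [NormedSpace ℂ E]
    (z : E) (A D : Set E) : EReal :=
  - sSup {y : EReal | ∃ u : E → EReal, PSHOn u D ∧ (∀ w ∈ D, u w ≤ 0) ∧
      (∀ w ∈ A, Filter.limsup u (nhdsWithin w (insert w D)) ≤ -1) ∧ y = u z}

/-- `ζ` is a regular boundary point of `Ω` if `ζ ∈ ∂Ω` and `ℂ \ Ω` is non-thin at `ζ`. -/
def RegularBoundaryPoint (Ω : Set ℂ) (ζ : ℂ) : Prop :=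
  ζ ∈ frontier Ω ∧ ¬ ThinAt Ωᶜ ζ

/-- The graph `Γ_f = {(z, f z) : z ∈ S} ⊆ ℂ²` of `f` over `S`. -/
def graphOver (f : ℂ → ℂ) (S : Set ℂ) : Set (ℂ × ℂ) := {p | p.1 ∈ S ∧ p.2 = f p.1}

/-- `e^x` for `x ∈ [-∞, ∞)`, as a map to `[0, ∞)`. -/
def expEReal (x : EReal) : ℝ := if x = ⊥ then 0 else Real.exp x.toReal

end

/-- `h` is continuous at `p` and supported from below at `p` by the real part of
a holomorphic function. -/
def Supp {E : Type*} [NormedAddCommGroup E] [NormedSpace ℂ E] (h : E → ℝ) (p : E) : Prop :=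
  ContinuousAt h p ∧ ∃ Φ : E → ℂ, AnalyticAt ℂ Φ p ∧ (Φ p).re = h p ∧ ∀ᶠ q in 𝓝 p, (Φ q).re ≤ h q

section SuppLemmas
variable {E : Type*} [NormedAddCommGroup E] [NormedSpace ℂ E]

theorem Supp.congr {h g : E → ℝ} {p : E} (hg : Supp g p) (e : h =ᶠ[𝓝 p] g) : Supp h p := by
  obtain ⟨c, Φ, a, b, d⟩ := hg
  refine ⟨c.congr e.symm, Φ, a, by rw [b, e.eq_of_nhds], ?_⟩
  filter_upwards [d, e] with q h1 h2
  rw [h2]; exact h1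

theorem supp_const (c : ℝ) (p : E) : Supp (fun _ => c) p :=
  ⟨continuousAt_const, fun _ => (c : ℂ), analyticAt_const, by simp, by simp⟩

theorem Supp.max' {g₁ g₂ : E → ℝ} {p : E} (h₁ : Supp g₁ p) (c₂ : ContinuousAt g₂ p)
    (h₂ : g₁ p < g₂ p → Supp g₂ p) : Supp (fun q => max (g₁ q) (g₂ q)) p := by
  refine ⟨h₁.1.max c₂, ?_⟩
  by_cases hlt : g₁ p < g₂ p
  · obtain ⟨c, Φ, a, b, d⟩ := h₂ hlt
    refine ⟨Φ, a, b.trans (max_eq_right hlt.le).symm, ?_⟩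
    filter_upwards [d] with q hq using hq.trans (le_max_right _ _)
  · obtain ⟨c, Φ, a, b, d⟩ := h₁
    refine ⟨Φ, a, b.trans (max_eq_left (not_lt.1 hlt)).symm, ?_⟩
    filter_upwards [d] with q hq using hq.trans (le_max_left _ _)

theorem Supp.max {g₁ g₂ : E → ℝ} {p : E} (h₁ : Supp g₁ p) (h₂ : Supp g₂ p) :
    Supp (fun q => max (g₁ q) (g₂ q)) p := h₁.max' h₂.1 (fun _ => h₂)

theorem Supp.add {g₁ g₂ : E → ℝ} {p : E} (h₁ : Supp g₁ p) (h₂ : Supp g₂ p) :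
    Supp (fun q => g₁ q + g₂ q) p := by
  obtain ⟨c, Φ, a, b, d⟩ := h₁
  obtain ⟨c', Φ', a', b', d'⟩ := h₂
  refine ⟨c.add c', fun q => Φ q + Φ' q, a.fun_add a', by simp [b, b'], ?_⟩
  filter_upwards [d, d'] with q h1 h2
  simp only [Complex.add_re]; linarith

theorem Supp.const_mul {g : E → ℝ} {p : E} (h : Supp g p) {s : ℝ} (hs : 0 ≤ s) :
    Supp (fun q => s * g q) p := by
  obtain ⟨c, Φ, a, b, d⟩ := h
  refine ⟨continuousAt_const.mul c, fun q => (s : ℂ) * Φ q, analyticAt_const.fun_mul a,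
    by simp [b], ?_⟩
  filter_upwards [d] with q h1
  simp only [Complex.re_ofReal_mul]
  exact mul_le_mul_of_nonneg_left h1 hs

/-- real multiples of `log ‖F‖`, `F` holomorphic and nonzero. -/
theorem supp_log {F : E → ℂ} {p : E} (hF : AnalyticAt ℂ F p) (h0 : F p ≠ 0) (s : ℝ) :
    Supp (fun q => s * Real.log ‖F q‖) p := by
  have hc : ContinuousAt F p := hF.continuousAt
  have h1 : F p / F p ∈ Complex.slitPlane := by
    rw [div_self h0]; exact Complex.one_mem_slitPlane
  have key : ∀ᶠ q in 𝓝 p, F q ≠ 0 := hc.eventually_ne h0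
  have e : ∀ q, F q ≠ 0 →
      ((s : ℂ) * (Complex.log (F q / F p) + (Real.log ‖F p‖ : ℝ))).re = s * Real.log ‖F q‖ := by
    intro q hq
    rw [Complex.re_ofReal_mul, Complex.add_re, Complex.log_re, norm_div, Complex.ofReal_re,
      Real.log_div (norm_ne_zero_iff.2 hq) (norm_ne_zero_iff.2 h0)]
    ring
  refine ⟨?_, fun q => (s : ℂ) * (Complex.log (F q / F p) + (Real.log ‖F p‖ : ℝ)), ?_, e p h0, ?_⟩
  · exact continuousAt_const.mul (hc.norm.log (norm_ne_zero_iff.2 h0))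
  · refine analyticAt_const.fun_mul (AnalyticAt.fun_add (AnalyticAt.clog ?_ h1) analyticAt_const)
    exact hF.fun_div analyticAt_const h0
  · filter_upwards [key] with q hq
    exact (e q hq).le

theorem Supp.comp {E' : Type*} [NormedAddCommGroup E'] [NormedSpace ℂ E'] {h : E' → ℝ}
    {F : E → E'} {p : E} (hh : Supp h (F p)) (hF : AnalyticAt ℂ F p) :
    Supp (fun q => h (F q)) p := by
  obtain ⟨c, Φ, a, b, d⟩ := hh
  refine ⟨ContinuousAt.comp' c hF.continuousAt, fun q => Φ (F q), a.fun_comp hF, b, ?_⟩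
  exact hF.continuousAt.eventually d

theorem supp_sum {ι : Type*} (t : Finset ι) (g : ι → E → ℝ) (p : E) (h : ∀ i ∈ t, Supp (g i) p) :
    Supp (fun q => ∑ i ∈ t, g i q) p := by
  classical
  induction t using Finset.induction_on with
  | empty => simpa using supp_const 0 p
  | insert i t hi ih =>
    have := (h i (by simp)).add (ih (fun k hk => h k (by simp [hk])))
    refine this.congr (Eventually.of_forall fun q => ?_)
    simp [Finset.sum_insert hi]

end SuppLemmas

/-- Comparison with real parts of entire functions on a disc. -/
theorem supp_compare {k : ℂ → ℝ} {c : ℂ} {r : ℝ} (hr : 0 < r)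
    (hk : ∀ z ∈ closedBall c r, Supp k z) {P : ℂ → ℂ} (hP : Differentiable ℂ P)
    (hle : ∀ z ∈ sphere c r, k z ≤ (P z).re) : k c ≤ (P c).re := by
  by_contra hcon
  push Not at hcon
  set η : ℝ := (k c - (P c).re) / (2 * r ^ 2) with hη
  have hηpos : 0 < η := by have : 0 < k c - (P c).re := by linarith
                           positivity
  have hηr : η * r ^ 2 = (k c - (P c).re) / 2 := by rw [hη]; field_simp
  have hcont : ContinuousOn (fun z => k z - (P z).re + η * ‖z - c‖ ^ 2) (closedBall c r) := by
    refine ContinuousOn.add (ContinuousOn.sub (fun z hz => (hk z hz).1.continuousWithinAt) ?_) ?_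
    · exact (Complex.continuous_re.comp hP.continuous).continuousOn
    · fun_prop
  obtain ⟨z, hz, hmax⟩ := (isCompact_closedBall c r).exists_isMaxOn ⟨c, by simp [hr.le]⟩ hcont
  have hzc := hmax (show c ∈ closedBall c r by simp [hr.le])
  simp only [mem_ofPred_eq, sub_self, norm_zero] at hzc
  have hzin : z ∈ ball c r := by
    by_contra hnot
    have hs : dist z c = r := le_antisymm hz (not_lt.1 hnot)
    have := hle z hs
    rw [← dist_eq_norm, hs] at hzc
    nlinarith
  obtain ⟨-, Φ, ha, hb, hd⟩ := hk z hz
  obtain ⟨ρ, hρ, hball⟩ := Metric.eventually_nhds_iff_ball.1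
    ((ha.eventually_analyticAt.and hd).and (isOpen_ball.mem_nhds hzin))
  set Ψ : ℂ → ℂ := fun ζ => Φ ζ - P ζ + 2 * (η : ℂ) * ((ζ - z) * (starRingEnd ℂ) (z - c)) with hΨ
  have hdiff : DifferentiableOn ℂ (fun ζ => Complex.exp (Ψ ζ)) (closedBall z (ρ / 2)) := by
    intro ζ hζ
    have hζ' : ζ ∈ ball z ρ := closedBall_subset_ball (by linarith) hζ
    have h1 := (hball ζ hζ').1.1.differentiableAt
    apply DifferentiableAt.differentiableWithinAt
    apply DifferentiableAt.cexp
    refine (h1.sub hP.differentiableAt).add ?_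
    fun_prop
  have hnorm : ∀ ζ ∈ frontier (ball z (ρ / 2)), ‖Complex.exp (Ψ ζ)‖ ≤
      Real.exp ((Ψ z).re - η * (ρ / 2) ^ 2) := by
    intro ζ hζ
    rw [frontier_ball z (by positivity)] at hζ
    have hζd : ‖ζ - z‖ = ρ / 2 := by rw [← dist_eq_norm]; exact hζ
    have hζ' : ζ ∈ ball z ρ := by rw [mem_ball, dist_eq_norm, hζd]; linarith
    have h1 := (hball ζ hζ').1.2
    have h2 := hmax (ball_subset_closedBall (hball ζ hζ').2)
    simp only [mem_ofPred_eq] at h2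
    rw [Complex.norm_exp]
    apply Real.exp_le_exp.2
    have h3 : ‖ζ - c‖ ^ 2 = ‖ζ - z‖ ^ 2 + ‖z - c‖ ^ 2
        + 2 * ((ζ - z) * (starRingEnd ℂ) (z - c)).re := by
      rw [← Complex.normSq_eq_norm_sq, ← Complex.normSq_eq_norm_sq, ← Complex.normSq_eq_norm_sq,
        show ζ - c = (ζ - z) + (z - c) by ring, Complex.normSq_add]
    have h4 : (Ψ ζ).re = (Φ ζ).re - (P ζ).re + 2 * η * ((ζ - z) * (starRingEnd ℂ) (z - c)).re := by
      rw [hΨ]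
      simp only [Complex.add_re, Complex.sub_re]
      rw [show (2 * (η : ℂ)) = ((2 * η : ℝ) : ℂ) by push_cast; ring, Complex.re_ofReal_mul]
    have h5 : (Ψ z).re = (Φ z).re - (P z).re := by rw [hΨ]; simp
    rw [h4, h5, hb]
    rw [h3, hζd] at h2
    nlinarith
  have := Complex.norm_le_of_forall_mem_frontier_norm_le (U := ball z (ρ / 2)) isBounded_ball
    (DifferentiableOn.diffContOnCl (by rw [closure_ball z (by positivity)]; exact hdiff)) hnorm
    (subset_closure (mem_ball_self (by positivity)))
  rw [Complex.norm_exp, Real.exp_le_exp] at this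
  have : 0 < η * (ρ / 2) ^ 2 := by positivity
  linarith

/-- Every continuous function on the circle is uniformly close to the real part of an entire
function. -/
theorem circle_approx {k : ℂ → ℝ} {c : ℂ} {r : ℝ} (hr : 0 < r)
    (hk : ContinuousOn k (sphere c r)) {ε : ℝ} (hε : 0 < ε) :
    ∃ P : ℂ → ℂ, Differentiable ℂ P ∧ ∀ z ∈ sphere c r, |k z - (P z).re| < ε := by
  have : Fact ((0 : ℝ) < 2 * Real.pi) := ⟨Real.two_pi_pos⟩
  have hmem : ∀ x : AddCircle (2 * Real.pi), c + r * (AddCircle.toCircle x : ℂ) ∈ sphere c r := by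
    intro x; simp [abs_of_pos hr, Circle.norm_coe]
  let g : C(AddCircle (2 * Real.pi), ℂ) := ⟨fun x => (k (c + r * (AddCircle.toCircle x : ℂ)) : ℂ), by
    refine Complex.continuous_ofReal.comp ?_
    refine hk.comp_continuous ?_ hmem
    have := AddCircle.continuous_toCircle (T := 2 * Real.pi)
    fun_prop⟩
  have hspan : ∀ φ ∈ Submodule.span ℂ (range <| @fourier (2 * Real.pi)),
      ∃ P Q : ℂ → ℂ, Differentiable ℂ P ∧ Differentiable ℂ Q ∧ ∀ x : AddCircle (2 * Real.pi),
        φ x = P (c + r * (AddCircle.toCircle x : ℂ))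
          + (starRingEnd ℂ) (Q (c + r * (AddCircle.toCircle x : ℂ))) := by
    intro φ hφ
    have hr' : (r : ℂ) ≠ 0 := by exact_mod_cast hr.ne'
    induction hφ using Submodule.span_induction with
    | mem φ h =>
      obtain ⟨n, rfl⟩ := h
      rcases Int.eq_nat_or_neg n with ⟨m, rfl | rfl⟩
      · refine ⟨fun z => ((z - c) / r) ^ m, fun _ => 0, by fun_prop, by fun_prop, fun x => ?_⟩
        simp [hr', fourier_apply, AddCircle.toCircle_nsmul]
      · refine ⟨fun _ => 0, fun z => ((z - c) / r) ^ m, by fun_prop, by fun_prop, fun x => ?_⟩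
        simp [hr', fourier_apply, ← Circle.coe_inv_eq_conj, AddCircle.toCircle_nsmul, AddCircle.toCircle_neg]
    | zero => exact ⟨fun _ => 0, fun _ => 0, by fun_prop, by fun_prop, by simp⟩
    | add φ ψ _ _ h1 h2 =>
      obtain ⟨P, Q, hP, hQ, h⟩ := h1
      obtain ⟨P', Q', hP', hQ', h'⟩ := h2
      refine ⟨fun z => P z + P' z, fun z => Q z + Q' z, by fun_prop, by fun_prop, fun x => ?_⟩
      rw [ContinuousMap.add_apply, h, h', map_add]; ring
    | smul a φ _ h1 =>
      obtain ⟨P, Q, hP, hQ, h⟩ := h1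
      refine ⟨fun z => a * P z, fun z => (starRingEnd ℂ) a * Q z, by fun_prop, by fun_prop,
        fun x => ?_⟩
      rw [ContinuousMap.smul_apply, h, map_mul, Complex.conj_conj, smul_eq_mul]; ring
  have hg : g ∈ closure ((Submodule.span ℂ (range <| @fourier (2 * Real.pi)) :
      Submodule ℂ C(AddCircle (2 * Real.pi), ℂ)) : Set C(AddCircle (2 * Real.pi), ℂ)) := by
    rw [← Submodule.topologicalClosure_coe, span_fourier_closure_eq_top]; trivial
  obtain ⟨φ, hφ, hd⟩ := Metric.mem_closure_iff.1 hg ε hε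
  obtain ⟨P, Q, hP, hQ, h⟩ := hspan φ hφ
  refine ⟨fun z => P z + Q z, by fun_prop, fun z hz => ?_⟩
  obtain ⟨x, hx⟩ : ∃ x : AddCircle (2 * Real.pi), c + r * (AddCircle.toCircle x : ℂ) = z := by
    have hz' : ‖z - c‖ = r := by rw [← dist_eq_norm]; exact hz
    refine ⟨((Complex.arg (z - c) : ℝ) : AddCircle (2 * Real.pi)), ?_⟩
    rw [AddCircle.toCircle_apply_mk]
    have := Complex.norm_mul_exp_arg_mul_I (z - c)
    rw [hz'] at this
    have h2 : 2 * Real.pi / (2 * Real.pi) = 1 := div_self Real.two_pi_pos.ne'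
    rw [h2, one_mul, Circle.coe_exp, this]; ring
  have h1 := lt_of_le_of_lt (ContinuousMap.dist_apply_le_dist (f := g) (g := φ) x) hd
  rw [h x, hx, dist_eq_norm] at h1
  have h2 : g x = (k z : ℂ) := by simp [g, hx]
  rw [h2] at h1
  refine lt_of_le_of_lt ?_ h1
  refine le_trans (le_of_eq ?_) (Complex.abs_re_le_norm _)
  simp

theorem supp_submean {k : ℂ → ℝ} {c : ℂ} {r : ℝ} (hr : 0 < r)
    (hk : ∀ z ∈ closedBall c r, Supp k z) : k c ≤ Real.circleAverage k c r := by
  have hcs : ContinuousOn k (sphere c r) := fun z hz =>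
    (hk z (sphere_subset_closedBall hz)).1.continuousWithinAt
  refine le_of_forall_pos_le_add fun ε hε => ?_
  obtain ⟨P, hP, hPk⟩ := circle_approx hr hcs (half_pos hε)
  have hP' : Differentiable ℂ (fun z => P z + ((ε / 2 : ℝ) : ℂ)) := by fun_prop
  have h1 := supp_compare hr hk hP' (fun z hz => by
    have := abs_lt.1 (hPk z hz)
    simp only [Complex.add_re, Complex.ofReal_re]; linarith)
  simp only [Complex.add_re, Complex.ofReal_re] at h1
  have hci : CircleIntegrable P c r := hP.continuous.continuousOn.circleIntegrable hr.le
  have h2 : Real.circleAverage (fun z => (P z).re) c r = (P c).re := by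
    have h3 := ContinuousLinearMap.circleAverage_comp_comm Complex.reCLM hci
    have h4 : Real.circleAverage P c r = P c := by
      exact (hP.diffContOnCl).circleAverage
    rw [h4] at h3
    exact h3
  have h5 : Real.circleAverage (fun z => (P z).re) c r ≤
      Real.circleAverage (fun z => k z + ε / 2) c r := by
    apply Real.circleAverage_mono
    · exact (Complex.continuous_re.comp hP.continuous).continuousOn.circleIntegrable hr.le
    · exact (hcs.add continuousOn_const).circleIntegrable hr.le
    · intro z hz
      rw [abs_of_pos hr] at hz
      have := abs_lt.1 (hPk z hz)
      linarith
  rw [Real.circleAverage_fun_add (hcs.circleIntegrable hr.le)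
    (continuousOn_const.circleIntegrable hr.le), Real.circleAverage_const] at h5
  linarith

theorem ae_summable_integrable_tsum {α : Type*} [MeasurableSpace α] {μ : Measure α}
    {F : ℕ → α → ℝ} (hF : ∀ i, Integrable (F i) μ) (hs : Summable fun i => ∫ a, ‖F i a‖ ∂μ) :
    (∀ᵐ a ∂μ, Summable fun i => F i a) ∧ Integrable (fun a => ∑' i, F i a) μ := by
  have h0 : ∀ i, ∫⁻ a, ‖F i a‖ₑ ∂μ = ENNReal.ofReal (∫ a, ‖F i a‖ ∂μ) := fun i => by
    rw [ofReal_integral_norm_eq_lintegral_enorm (hF i)]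
  have h1 : ∫⁻ a, ∑' i, ‖F i a‖ₑ ∂μ ≠ ⊤ := by
    rw [lintegral_tsum fun i => (hF i).1.enorm]
    simp_rw [h0]
    exact hs.tsum_ofReal_ne_top
  have h2 : ∀ᵐ a ∂μ, ∑' i, ‖F i a‖ₑ < ⊤ :=
    ae_lt_top' (AEMeasurable.tsum fun i => (hF i).1.enorm) h1
  have h3 : ∀ᵐ a ∂μ, Summable fun i => F i a := by
    filter_upwards [h2] with a ha
    have : Summable fun i => ‖F i a‖₊ := ENNReal.tsum_coe_ne_top_iff_summable.1 ha.ne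
    exact Summable.of_nnnorm this
  refine ⟨h3, ?_, ?_⟩
  · refine aestronglyMeasurable_of_tendsto_ae atTop
      (f := fun n a => ∑ i ∈ Finset.range n, F i a) (fun n => ?_) ?_
    · exact Finset.aestronglyMeasurable_fun_sum _ fun i _ => (hF i).1
    · filter_upwards [h3] with a ha using ha.hasSum.tendsto_sum_nat
  · refine lt_of_le_of_lt (lintegral_mono_ae ?_) h1.lt_top
    filter_upwards [h2] with a ha
    have : Summable fun i => ‖F i a‖₊ := ENNReal.tsum_coe_ne_top_iff_summable.1 ha.ne
    have h4 := nnnorm_tsum_le this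
    calc ‖∑' i, F i a‖ₑ ≤ ((∑' i, ‖F i a‖₊ : NNReal) : ENNReal) := by exact_mod_cast h4
      _ = _ := ENNReal.coe_tsum this

open Classical in
/-- sum of a series in `[-∞, ∞)` -/
noncomputable def eSum (a : ℕ → ℝ) : EReal := if Summable a then ((∑' j, a j : ℝ) : EReal) else ⊥

theorem eSum_le {a : ℕ → ℝ} {J n : ℕ} (hn : J ≤ n) (h : ∀ j ≥ J, a j ≤ 0) :
    eSum a ≤ ((∑ i ∈ Finset.range n, a i : ℝ) : EReal) := by
  unfold eSum
  split_ifs with hs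
  · rw [EReal.coe_le_coe_iff, ← hs.sum_add_tsum_nat_add n]
    have : ∑' i, a (i + n) ≤ 0 := tsum_nonpos fun i => h _ (by omega)
    linarith
  · exact bot_le

theorem eSum_lt {a : ℕ → ℝ} {J : ℕ} (h : ∀ j ≥ J, a j ≤ 0) {y : EReal} (hy : eSum a < y) :
    ∃ n ≥ J, ((∑ i ∈ Finset.range n, a i : ℝ) : EReal) < y := by
  unfold eSum at hy
  split_ifs at hy with hs
  · have h1 : Tendsto (fun n => ((∑ i ∈ Finset.range n, a i : ℝ) : EReal)) atTop
        (𝓝 ((∑' j, a j : ℝ) : EReal)) :=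
      (continuous_coe_real_ereal.tendsto _).comp hs.hasSum.tendsto_sum_nat
    obtain ⟨n, h2, h3⟩ := ((h1.eventually_lt_const hy).and (eventually_ge_atTop J)).exists
    exact ⟨n, h3, h2⟩
  · obtain ⟨x, -, hx⟩ := EReal.lt_iff_exists_real_btwn.1 hy
    have hns : ¬ Summable fun i => - a (i + J) := by
      rw [summable_neg_iff, summable_nat_add_iff]; exact hs
    rw [not_summable_iff_tendsto_nat_atTop_of_nonneg fun i => by
      have := h (i + J) (by omega); linarith] at hns
    obtain ⟨n, hn⟩ := (hns.eventually_gt_atTop (∑ i ∈ Finset.range J, a i - x)).exists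
    refine ⟨J + n, by omega, lt_trans ?_ hx⟩
    rw [EReal.coe_lt_coe_iff, Finset.sum_range_add]
    rw [Finset.sum_neg_distrib] at hn
    simp_rw [add_comm _ J] at hn
    linarith

theorem sum_psh {E : Type*} [NormedAddCommGroup E] [NormedSpace ℂ E] [LocallyCompactSpace E]
    {Ω S : Set E} (hΩ : IsOpen Ω) (hc : IsPreconnected Ω) {h : ℕ → E → ℝ}
    (hs : ∀ j, ∀ p ∈ Ω, Supp (h j) p)
    (hneg : ∀ K ⊆ Ω, IsCompact K → ∃ J, ∀ j ≥ J, ∀ p ∈ K, h j p ≤ 0)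
    (hS : ∀ p ∈ Ω, p ∈ S → ∀ᶠ j in atTop, h j p ≤ -1)
    (hC : ∀ p ∈ Ω, p ∉ S → ∀ᶠ j in atTop, -(1 / 2 : ℝ) ^ j ≤ h j p)
    (hne : ∃ p ∈ Ω, p ∉ S) : CompletePluripolarIn S Ω := by
  have hneg1 : ∀ p ∈ Ω, ∃ J, ∀ j ≥ J, h j p ≤ 0 := fun p hp => by
    obtain ⟨J, hJ⟩ := hneg {p} (by simpa using hp) isCompact_singleton
    exact ⟨J, fun j hj => hJ j hj p rfl⟩
  have hsum : ∀ p ∈ Ω, (Summable (fun j => h j p) ↔ p ∉ S) := by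
    intro p hp
    constructor
    · intro h1 h2
      have h3 := h1.tendsto_atTop_zero
      obtain ⟨j, h4, h5⟩ := ((h3.eventually_const_lt (show (-1 : ℝ) < 0 by norm_num)).and
        (hS p hp h2)).exists
      linarith
    · intro h1
      obtain ⟨J, hJ⟩ := hneg1 p hp
      refine Summable.of_norm_bounded_eventually_nat (g := fun j => (1 / 2 : ℝ) ^ j)
        (summable_geometric_of_lt_one (by norm_num) (by norm_num)) ?_
      filter_upwards [hC p hp h1, eventually_ge_atTop J] with j h2 h3
      rw [Real.norm_eq_abs, abs_of_nonpos (hJ j h3)]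
      linarith
  have hbot : ∀ p ∈ Ω, (eSum (fun j => h j p) = ⊥ ↔ p ∈ S) := by
    intro p hp
    by_cases h1 : p ∈ S
    · simp only [h1, iff_true]
      unfold eSum
      rw [if_neg]
      intro h2; exact (hsum p hp).1 h2 h1
    · simp only [h1, iff_false]
      unfold eSum
      rw [if_pos ((hsum p hp).2 h1)]
      exact EReal.coe_ne_bot _
  refine ⟨fun p => eSum (fun j => h j p), ⟨?_, ?_, ?_, ?_⟩, hbot⟩
  · intro p _
    dsimp only [eSum]
    split_ifs
    · exact EReal.coe_ne_top _
    · exact bot_ne_top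
  · intro p hp y hy
    obtain ⟨K, hK, hKΩ, hKc⟩ := local_compact_nhds (hΩ.mem_nhds hp)
    obtain ⟨J, hJ⟩ := hneg K hKΩ hKc
    obtain ⟨n, hn, hlt⟩ := eSum_lt (fun j hj => hJ j hj p (mem_of_mem_nhds hK)) hy
    apply mem_nhdsWithin_of_mem_nhds
    have hcont : ContinuousAt (fun q => ((∑ i ∈ Finset.range n, h i q : ℝ) : EReal)) p := by
      apply continuous_coe_real_ereal.continuousAt.comp
      exact tendsto_finsetSum _ fun i _ => (hs i p hp).1
    filter_upwards [hK, hcont.eventually_lt_const hlt] with q h1 h2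
    exact lt_of_le_of_lt (eSum_le hn fun j hj => hJ j hj q h1) h2
  · intro p hp
    obtain ⟨w, hw, hwS⟩ := hne
    refine ⟨w, ?_, fun hb => hwS ((hbot w hw).1 hb)⟩
    rw [hc.connectedComponentIn hp]; exact hw
  · intro a b c r hr hin
    beta_reduce
    by_cases hsc : Summable fun j => h j (a + c • b)
    swap
    · have : eSum (fun j => h j (a + c • b)) = ⊥ := by unfold eSum; rw [if_neg hsc]
      rw [this]; exact bot_le
    have hK : IsCompact ((fun l : ℂ => a + l • b) '' closedBall c r) :=
      (isCompact_closedBall c r).image (by fun_prop)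
    obtain ⟨J, hJ⟩ := hneg _ (by rintro _ ⟨l, hl, rfl⟩; exact hin l hl) hK
    have hsupp : ∀ j, ∀ l ∈ closedBall c r, Supp (fun l : ℂ => h j (a + l • b)) l := by
      intro j l hl
      refine (hs j _ (hin l hl)).comp (F := fun l : ℂ => a + l • b) ?_
      exact analyticAt_const.fun_add (analyticAt_id.fun_smul analyticAt_const)
    have hmem : ∀ θ, circleMap c r θ ∈ closedBall c r := fun θ =>
      sphere_subset_closedBall (circleMap_mem_sphere c hr.le θ)
    set F : ℕ → ℝ → ℝ := fun j θ => h j (a + circleMap c r θ • b) with hFdef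
    set μ := volume.restrict (Set.Ioc (0:ℝ) (2 * Real.pi)) with hμ
    have hFc : ∀ j, Continuous (F j) := by
      intro j
      rw [continuous_iff_continuousAt]
      intro θ
      exact ContinuousAt.comp' (f := circleMap c r) (hsupp j _ (hmem θ)).1
        (continuous_circleMap c r).continuousAt
    have hFi : ∀ j, Integrable (F j) μ := fun j =>
      (intervalIntegrable_iff_integrableOn_Ioc_of_le Real.two_pi_pos.le).1
        ((hFc j).intervalIntegrable 0 (2 * Real.pi))
    have havg : ∀ j, 2 * Real.pi * h j (a + c • b) ≤ ∫ θ, F j θ ∂μ := by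
      intro j
      have h1 := supp_submean hr (hsupp j)
      unfold Real.circleAverage at h1
      rw [intervalIntegral.integral_of_le Real.two_pi_pos.le, smul_eq_mul] at h1
      have h2 : ∫ θ in Ioc 0 (2 * Real.pi), h j (a + circleMap c r θ • b) = ∫ θ, F j θ ∂μ := rfl
      rw [h2] at h1
      rwa [← div_eq_inv_mul, le_div_iff₀' Real.two_pi_pos] at h1
    have hnormsum : Summable fun j => ∫ θ, ‖F j θ‖ ∂μ := by
      rw [← summable_nat_add_iff J]
      have h1 : Summable fun j => - (2 * Real.pi * h (j + J) (a + c • b)) :=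
        (((summable_nat_add_iff J).2 hsc).mul_left _).neg
      refine Summable.of_nonneg_of_le (fun j => integral_nonneg fun θ => norm_nonneg _) ?_ h1
      intro j
      have h2 : ∀ θ, ‖F (j + J) θ‖ = - F (j + J) θ := fun θ => by
        rw [Real.norm_eq_abs, abs_of_nonpos]
        exact hJ (j + J) (by omega) _ ⟨_, hmem θ, rfl⟩
      simp_rw [h2]
      rw [integral_neg]
      exact neg_le_neg (havg _)
    obtain ⟨hae, hIntg⟩ := ae_summable_integrable_tsum hFi hnormsum
    have hHS := hasSum_integral_of_summable_integral_norm hFi hnormsum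
    have hv : (fun θ => ∑' j, F j θ) =ᵐ[μ]
        fun θ => (eSum (fun j => h j (a + circleMap c r θ • b))).toReal := by
      filter_upwards [hae] with θ hθ
      have : eSum (fun j => h j (a + circleMap c r θ • b)) = ((∑' j, F j θ : ℝ) : EReal) := by
        unfold eSum; rw [if_pos hθ]
      rw [this, EReal.toReal_coe]
    unfold circleAvg
    rw [if_pos]
    · have h1 : eSum (fun j => h j (a + c • b)) = ((∑' j, h j (a + c • b) : ℝ) : EReal) := by
        unfold eSum; rw [if_pos hsc]
      rw [h1, EReal.coe_le_coe_iff, intervalIntegral.integral_of_le Real.two_pi_pos.le,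
        le_div_iff₀' Real.two_pi_pos, ← tsum_mul_left]
      refine (Summable.tsum_le_tsum havg (hsc.mul_left _) hHS.summable).trans (le_of_eq ?_)
      rw [hHS.tsum_eq]
      exact integral_congr_ae hv
    · constructor
      · rw [intervalIntegrable_iff_integrableOn_Ioc_of_le Real.two_pi_pos.le]
        exact hIntg.congr hv
      · filter_upwards [hae] with θ hθ
        unfold eSum; rw [if_pos hθ]; exact EReal.coe_ne_bot _

theorem simplex_opt {ι : Type*} [Fintype ι] [Nonempty ι] (a : ι → ι → ℝ)
    (ha : ∀ i j, a i j = a j i) : ∃ (c : ι → ℝ) (q : ℝ), (∀ i, 0 ≤ c i) ∧ ∑ i, c i = 1 ∧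
      (∀ i, ∑ j, c j * a i j ≤ q) ∧ ∀ i, c i ≠ 0 → ∑ j, c j * a i j = q := by
  classical
  set Q : (ι → ℝ) → ℝ := fun c => ∑ i, c i * ∑ j, c j * a i j with hQ
  have hcont : Continuous Q := by fun_prop
  obtain ⟨c, hc, hmax⟩ := (isCompact_stdSimplex ℝ ι).exists_isMaxOn
    ⟨_, single_mem_stdSimplex ℝ (Classical.arbitrary ι)⟩ hcont.continuousOn
  have h1 : ∀ i, ∑ j, c j * a i j ≤ Q c := by
    intro i
    by_contra hcon
    push Not at hcon
    set x := ∑ j, c j * a i j with hx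
    -- expand along the segment to the vertex
    have hexp : ∀ s : ℝ, Q (fun k => (1 - s) * c k + s * (if k = i then 1 else 0)) =
        (1 - s) ^ 2 * Q c + 2 * (1 - s) * s * x + s ^ 2 * a i i := by
      intro s
      have e1 : ∀ k, ∑ j, ((1 - s) * c j + s * (if j = i then 1 else 0)) * a k j =
          (1 - s) * ∑ j, c j * a k j + s * a k i := by
        intro k
        simp only [add_mul, Finset.sum_add_distrib, mul_assoc, ite_mul, one_mul, zero_mul,
          mul_ite, mul_zero, Finset.sum_ite_eq', Finset.mem_univ, if_true, Finset.mul_sum]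
      simp only [hQ, e1]
      have e2 : ∑ k, c k * a k i = x := by
        rw [hx]; exact Finset.sum_congr rfl fun k _ => by rw [ha]
      have e3 : ∀ k, ((1 - s) * c k + s * (if k = i then 1 else 0)) *
          ((1 - s) * ∑ j, c j * a k j + s * a k i) =
          (1 - s) ^ 2 * (c k * ∑ j, c j * a k j) + (1 - s) * s * (c k * a k i) +
          (if k = i then s * ((1 - s) * ∑ j, c j * a k j + s * a k i) else 0) := by
        intro k
        split_ifs <;> ring
      simp only [e3, Finset.sum_add_distrib, ← Finset.mul_sum, e2, Finset.sum_ite_eq',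
        Finset.mem_univ, if_true]
      rw [← hx]; ring
    have hle : ∀ s : ℝ, 0 ≤ s → s ≤ 1 →
        (1 - s) ^ 2 * Q c + 2 * (1 - s) * s * x + s ^ 2 * a i i ≤ Q c := by
      intro s hs hs1
      rw [← hexp]
      apply hmax
      refine ⟨fun k => ?_, ?_⟩
      · have := hc.1 k
        have : 0 ≤ (1 - s) * c k := mul_nonneg (by linarith) this
        beta_reduce
        split_ifs <;> simp <;> linarith
      · simp [Finset.sum_add_distrib, ← Finset.mul_sum, hc.2]
    -- small s
    set d := x - Q c with hd
    have hd0 : 0 < d := by linarith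
    set m := |Q c - 2 * x + a i i| + 1 + d with hm
    have hm0 : 0 < m := by positivity
    have h2 := hle (d / m) (by positivity) (by rw [div_le_one hm0, hm]; linarith [abs_nonneg (Q c - 2 * x + a i i)])
    have h3 : 0 < d / m := by positivity
    have h4 : (d / m) * m = d := by field_simp
    have h5 := neg_abs_le (Q c - 2 * x + a i i)
    have h6 : (d / m) * (2 * d + (d / m) * (Q c - 2 * x + a i i)) ≤ 0 := by
      nlinarith
    have h7 : 2 * d + (d / m) * (Q c - 2 * x + a i i) ≤ 0 := by
      by_contra h
      push Not at h
      have := mul_pos h3 h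
      linarith
    have h8 : (d / m) * (-m) ≤ (d / m) * (Q c - 2 * x + a i i) :=
      mul_le_mul_of_nonneg_left (by linarith) h3.le
    linarith
  refine ⟨c, Q c, hc.1, hc.2, h1, ?_⟩
  intro i hi
  by_contra hne
  have hlt := lt_of_le_of_ne (h1 i) hne
  have : Q c < ∑ k, c k * Q c := by
    apply Finset.sum_lt_sum
    · intro k _; exact mul_le_mul_of_nonneg_left (h1 k) (hc.1 k)
    · exact ⟨i, Finset.mem_univ _, mul_lt_mul_of_pos_left hlt (lt_of_le_of_ne (hc.1 i) hi.symm)⟩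
  rw [← Finset.sum_mul, hc.2, one_mul] at this
  exact lt_irrefl _ this

/-- truncated logarithmic potential of a discrete measure -/
noncomputable def pot (t : Finset ℂ) (c : ℂ → ℝ) (δ : ℝ) (z : ℂ) : ℝ :=
  ∑ w ∈ t, c w * Real.log (max ‖z - w‖ δ)

theorem pot_le_add {t : Finset ℂ} {c : ℂ → ℝ} {δ : ℝ} (hδ : 0 < δ) (hc : ∀ w, 0 ≤ c w)
    (h1 : ∑ w ∈ t, c w = 1) {z z' : ℂ} {C : ℝ} (hC : 0 < C)
    (h : ∀ w ∈ t, max ‖z - w‖ δ ≤ C * max ‖z' - w‖ δ) :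
    pot t c δ z ≤ pot t c δ z' + Real.log C := by
  have : Real.log C = ∑ w ∈ t, c w * Real.log C := by rw [← Finset.sum_mul, h1, one_mul]
  rw [this]
  unfold pot
  rw [← Finset.sum_add_distrib]
  apply Finset.sum_le_sum
  intro w hw
  rw [← mul_add]
  apply mul_le_mul_of_nonneg_left _ (hc w)
  have hp : 0 < max ‖z' - w‖ δ := lt_max_of_lt_right hδ
  rw [← Real.log_mul hp.ne' hC.ne', mul_comm]
  exact Real.log_le_log (lt_max_of_lt_right hδ) (h w hw)

theorem equilibrium {K : Set ℂ} (hK : IsCompact K) (hne : K.Nonempty) {δ : ℝ} (hδ : 0 < δ) :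
    ∃ (t : Finset ℂ) (c : ℂ → ℝ) (q : ℝ), (↑t ⊆ K) ∧ (∀ w, 0 ≤ c w) ∧ ∑ w ∈ t, c w = 1 ∧
      (∀ z, q - Real.log 2 ≤ pot t c δ z) ∧
      ∀ z, (∃ a ∈ K, dist z a ≤ δ) → pot t c δ z ≤ q + Real.log 3 := by
  classical
  obtain ⟨N0, hN0K, hN0f, hN0⟩ := hK.finite_cover_balls hδ
  lift N0 to Finset ℂ using hN0f
  have hNne : N0.Nonempty := by
    obtain ⟨a, ha⟩ := hne
    obtain ⟨n, hn, -⟩ := mem_iUnion₂.1 (hN0 ha)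
    exact ⟨n, hn⟩
  have : Nonempty N0 := hNne.to_subtype
  obtain ⟨c, q, hc0, hc1, hle, heq⟩ := simplex_opt
    (fun i j : N0 => Real.log (max ‖(i : ℂ) - j‖ δ)) (fun i j => by rw [norm_sub_rev])
  set c' : ℂ → ℝ := fun w => if h : w ∈ N0 then c ⟨w, h⟩ else 0 with hc'
  have hc'0 : ∀ w, 0 ≤ c' w := by
    intro w; simp only [hc']; split_ifs
    · exact hc0 _
    · exact le_rfl
  have hc'v : ∀ i : N0, c' i = c i := by intro i; simp [hc']
  set t := N0.filter (fun w => c' w ≠ 0) with ht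
  have hsum : ∀ g : ℂ → ℝ, ∑ w ∈ t, c' w * g w = ∑ i : N0, c i * g i := by
    intro g
    rw [ht, Finset.sum_filter_of_ne (fun w _ h => left_ne_zero_of_mul h),
      ← Finset.sum_coe_sort]
    exact Finset.sum_congr rfl fun i _ => by rw [hc'v]
  have hs1 : ∑ w ∈ t, c' w = 1 := by
    have := hsum (fun _ => 1)
    simp only [mul_one] at this
    rw [this, hc1]
  have hpot : ∀ z, pot t c' δ z = ∑ j : N0, c j * Real.log (max ‖z - j‖ δ) := fun z => hsum _
  have htne : t.Nonempty := by
    by_contra h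
    rw [Finset.not_nonempty_iff_eq_empty] at h
    rw [h] at hs1; simp at hs1
  refine ⟨t, c', q, ?_, hc'0, hs1, ?_, ?_⟩
  · intro w hw
    exact hN0K (Finset.mem_filter.1 hw).1
  · intro z
    obtain ⟨w', hw', hmin⟩ := t.exists_min_image (fun w => ‖z - w‖) htne
    have hw'q : pot t c' δ w' = q := by
      obtain ⟨h1, h2⟩ := Finset.mem_filter.1 hw'
      rw [hpot]
      refine heq ⟨w', h1⟩ ?_
      rw [← hc'v]; exact h2
    have := pot_le_add (z := w') (z' := z) hδ hc'0 hs1 (C := 2) (by norm_num) (by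
      intro w hw
      have h1 : ‖w' - w‖ ≤ ‖z - w'‖ + ‖z - w‖ := by
        rw [norm_sub_rev z w']
        calc ‖w' - w‖ = ‖(w' - z) + (z - w)‖ := by ring_nf
          _ ≤ _ := norm_add_le _ _
      have h2 := hmin w hw
      have h3 := le_max_left ‖z - w‖ δ
      have h4 := le_max_right ‖z - w‖ δ
      apply max_le <;> linarith)
    linarith
  · rintro z ⟨a, ha, haz⟩
    obtain ⟨n, hn, han⟩ := mem_iUnion₂.1 (hN0 ha)
    have hnq : pot t c' δ n ≤ q := by
      rw [hpot]; exact hle ⟨n, hn⟩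
    have := pot_le_add (z := z) (z' := n) hδ hc'0 hs1 (C := 3) (by norm_num) (by
      intro w hw
      have h1 : dist z w ≤ dist z a + dist a n + dist n w := dist_triangle4 _ _ _ _
      rw [dist_eq_norm z w, dist_eq_norm n w] at h1
      have h2 : dist a n < δ := han
      have h3 := le_max_left ‖n - w‖ δ
      have h4 := le_max_right ‖n - w‖ δ
      apply max_le <;> linarith)
    linarith

theorem usc_max {u : ℂ → EReal} (hu : UpperSemicontinuousOn u univ) (ht : ∀ z, u z ≠ ⊤)
    {g : ℂ → ℝ} (hg : Continuous g) {C : Set ℂ} (hC : IsCompact C) {z0 : ℂ} (hz0 : z0 ∈ C)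
    (hz0b : u z0 ≠ ⊥) : ∃ x ∈ C, u x ≠ ⊥ ∧
      ∀ z ∈ C, u z ≠ ⊥ → (u z).toReal + g z ≤ (u x).toReal + g x := by
  have h1 : UpperSemicontinuousOn (fun z => u z + (g z : EReal)) C := by
    refine UpperSemicontinuousOn.add' (hu.mono (subset_univ _)) ?_ ?_
    · exact (continuous_coe_real_ereal.comp hg).upperSemicontinuous.upperSemicontinuousOn C
    · intro x _
      exact EReal.continuousAt_add (Or.inl (ht x)) (Or.inr (EReal.coe_ne_top _))
  obtain ⟨x, hx, hmax⟩ := h1.exists_isMaxOn ⟨z0, hz0⟩ hC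
  have key : ∀ z, u z ≠ ⊥ → u z + (g z : EReal) = (((u z).toReal + g z : ℝ) : EReal) := by
    intro z hz
    rw [EReal.coe_add, EReal.coe_toReal (ht z) hz]
  have hxb : u x ≠ ⊥ := by
    intro hb
    have := hmax hz0
    simp only [mem_ofPred_eq, hb, EReal.bot_add] at this
    rw [key z0 hz0b] at this
    exact EReal.coe_ne_bot _ (le_bot_iff.1 this)
  refine ⟨x, hx, hxb, fun z hz hzb => ?_⟩
  have := hmax hz
  simp only [mem_ofPred_eq] at this
  rw [key z hzb, key x hxb, EReal.coe_le_coe_iff] at this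
  exact this

theorem no_strict_max {u : ℂ → EReal} (hu : SubharmonicOn u univ) {x : ℂ} (hx : u x ≠ ⊥)
    {s : ℝ} (hs : 0 < s) {k : ℂ → ℝ} (hk : ∀ z ∈ closedBall x s, Supp k z) {m : ℝ} (hm : 0 < m)
    (h : ∀ z ∈ sphere x s, u z ≠ ⊥ → (u z).toReal + k z ≤ (u x).toReal + k x - m) : False := by
  have h1 := hu.2.2.2 0 1 x s hs (fun _ _ => mem_univ _)
  simp only [smul_eq_mul, mul_one, zero_add] at h1
  unfold circleAvg at h1
  split_ifs at h1 with hc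
  · obtain ⟨hci, hcb⟩ := hc
    rw [← EReal.coe_toReal (hu.1 x (mem_univ _)) hx, EReal.coe_le_coe_iff] at h1
    have hsm := supp_submean hs hk
    have hcs : ContinuousOn k (sphere x s) := fun z hz =>
      (hk z (sphere_subset_closedBall hz)).1.continuousWithinAt
    have hki : CircleIntegrable k x s := hcs.circleIntegrable hs.le
    unfold Real.circleAverage at hsm
    have hle : ∫ θ in (0:ℝ)..(2 * Real.pi), (u (circleMap x s θ)).toReal ≤
        ∫ θ in (0:ℝ)..(2 * Real.pi), ((u x).toReal + k x - m - k (circleMap x s θ)) := by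
      apply intervalIntegral.integral_mono_ae_restrict Real.two_pi_pos.le hci
        (intervalIntegrable_const.sub hki)
      rw [Measure.restrict_congr_set Ioc_ae_eq_Icc.symm]
      filter_upwards [hcb] with θ hθ
      have := h _ (circleMap_mem_sphere x hs.le θ) hθ
      linarith
    rw [intervalIntegral.integral_sub intervalIntegrable_const hki,
      intervalIntegral.integral_const] at hle
    have hp := Real.two_pi_pos
    rw [smul_eq_mul, ← div_eq_inv_mul, le_div_iff₀ hp] at hsm
    rw [le_div_iff₀ hp] at h1
    rw [smul_eq_mul] at hle
    nlinarith
  · exact hx (le_bot_iff.1 h1)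

theorem pot_supp {t : Finset ℂ} {c : ℂ → ℝ} {δ : ℝ} (hδ : 0 < δ) (s : ℝ) {z : ℂ}
    (hz : ∀ w ∈ t, δ < ‖z - w‖) : Supp (fun z => s * pot t c δ z) z := by
  have h1 : Supp (fun z => ∑ w ∈ t, (s * c w) * Real.log ‖z - w‖) z := by
    apply supp_sum
    intro w hw
    refine supp_log (F := fun z => z - w) (analyticAt_id.fun_sub analyticAt_const) ?_ _
    exact norm_pos_iff.1 (hδ.trans (hz w hw))
  refine h1.congr ?_
  have h2 : ∀ᶠ y in 𝓝 z, ∀ w ∈ t, δ < ‖y - w‖ := by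
    rw [Filter.eventually_all_finset]
    intro w hw
    have : ContinuousAt (fun y => ‖y - w‖) z := by fun_prop
    exact this.eventually_const_lt (hz w hw)
  filter_upwards [h2] with y hy
  unfold pot
  rw [Finset.mul_sum]
  apply Finset.sum_congr rfl
  intro w hw
  rw [max_eq_left (hy w hw).le]; ring

theorem pot_continuous {t : Finset ℂ} {c : ℂ → ℝ} {δ : ℝ} (hδ : 0 < δ) :
    Continuous (pot t c δ) := by
  unfold pot
  refine continuous_finsetSum _ fun w _ => continuous_const.mul ?_
  refine Continuous.log (by fun_prop) fun z => ?_
  exact (lt_max_of_lt_right hδ).ne'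

theorem pot_ge {t : Finset ℂ} {c : ℂ → ℝ} {δ d : ℝ} (hd : 0 < d) (hc : ∀ w, 0 ≤ c w)
    (h1 : ∑ w ∈ t, c w = 1) {z : ℂ} (h : ∀ w ∈ t, d ≤ max ‖z - w‖ δ) :
    Real.log d ≤ pot t c δ z := by
  have : Real.log d = ∑ w ∈ t, c w * Real.log d := by rw [← Finset.sum_mul, h1, one_mul]
  rw [this]
  exact Finset.sum_le_sum fun w hw => mul_le_mul_of_nonneg_left (Real.log_le_log hd (h w hw)) (hc w)

theorem pot_le {t : Finset ℂ} {c : ℂ → ℝ} {δ d : ℝ} (hδ : 0 < δ) (hc : ∀ w, 0 ≤ c w)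
    (h1 : ∑ w ∈ t, c w = 1) {z : ℂ} (h : ∀ w ∈ t, max ‖z - w‖ δ ≤ d) :
    pot t c δ z ≤ Real.log d := by
  have : Real.log d = ∑ w ∈ t, c w * Real.log d := by rw [← Finset.sum_mul, h1, one_mul]
  rw [this]
  exact Finset.sum_le_sum fun w hw => mul_le_mul_of_nonneg_left
    (Real.log_le_log (lt_max_of_lt_right hδ) (h w hw)) (hc w)

theorem polar_pot {A K : Set ℂ} (hA : PolarSet A) (hKA : K ⊆ A) (hK : IsCompact K) (M : ℝ) :
    ∃ δ0 > 0, ∀ δ, 0 < δ → δ < δ0 → ∀ (t : Finset ℂ) (c : ℂ → ℝ), ↑t ⊆ K → (∀ w, 0 ≤ c w) →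
      ∑ w ∈ t, c w = 1 → ∃ z, pot t c δ z < -M := by
  obtain ⟨u, hu, huA⟩ := hA
  obtain ⟨z0, -, hz0⟩ := hu.2.2.1 0 (mem_univ _)
  have hT : ∀ z, u z ≠ ⊤ := fun z => hu.1 z (mem_univ _)
  obtain ⟨r, hr0, hr⟩ := hK.isBounded.exists_pos_norm_le
  set L := ‖z0‖ + r with hL
  have hLpos : 0 < L := by positivity
  set R := r + L * Real.exp 3 with hR
  have hRr : Real.log (R - r) = Real.log L + 3 := by
    rw [hR, add_sub_cancel_left, Real.log_mul hLpos.ne' (Real.exp_pos 3).ne', Real.log_exp]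
  have he3 : 1 ≤ Real.exp 3 := Real.one_le_exp (by norm_num)
  have hRL : L + r ≤ R := by rw [hR]; nlinarith
  have hR0 : 0 < R := by linarith
  have hz0R : ‖z0‖ < R := by linarith
  -- upper bound of u
  obtain ⟨x1, hx1, hx1b, hx1m⟩ := usc_max hu.2.1 hT (continuous_const (y := (0:ℝ)))
    (isCompact_closedBall 0 R) (mem_closedBall_zero_iff.2 hz0R.le) hz0
  set U := (u x1).toReal with hU
  set a0 := (u z0).toReal with ha0
  have hUa : a0 ≤ U := by have := hx1m z0 (mem_closedBall_zero_iff.2 hz0R.le) hz0; simpa using this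
  set ε := 1 / (U - a0 + 1) with hε
  have hε0 : 0 < ε := by have : 0 < U - a0 + 1 := by linarith
                         positivity
  have hεU : U - a0 ≤ 1 / ε := by rw [hε, one_div_one_div]; linarith
  set η := 1 / R ^ 2 with hη
  have hη0 : 0 < η := by positivity
  have hηR : η * R ^ 2 = 1 := by rw [hη]; field_simp
  set T := -(a0 - Real.log L / ε - (M + 1) / ε) + 1 with hTd
  have hopen : IsOpen {z | u z < ((-T : ℝ) : EReal)} := by
    have := upperSemicontinuousOn_univ_iff.1 hu.2.1
    exact this.isOpen_preimage _
  obtain ⟨δ1, hδ1, hth⟩ := hK.exists_thickening_subset_open hopen (fun z hz => by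
    simp only [mem_ofPred_eq, huA z (hKA hz)]; exact EReal.bot_lt_coe _)
  refine ⟨min δ1 r, by positivity, ?_⟩
  intro δ hδ hδlt t c ht hc hc1
  by_contra hcon
  push Not at hcon
  have hδr : δ < r := hδlt.trans_le (min_le_right _ _)
  -- the auxiliary function
  set g : ℂ → ℝ := fun z => (-pot t c δ z + η * ‖z‖ ^ 2) / ε with hg
  have hgc : Continuous g := by
    have := pot_continuous (t := t) (c := c) hδ
    fun_prop
  obtain ⟨x, hx, hxb, hxm⟩ := usc_max hu.2.1 hT hgc (isCompact_closedBall 0 R)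
    (mem_closedBall_zero_iff.2 hz0R.le) hz0
  have hp0 : pot t c δ z0 ≤ Real.log L := by
    refine pot_le hδ hc hc1 fun w hw => max_le ?_ ?_
    · have := hr w (ht hw)
      exact (norm_sub_le _ _).trans (by linarith)
    · have := norm_nonneg z0; linarith
  have hxz0 := hxm z0 (mem_closedBall_zero_iff.2 hz0R.le) hz0
  have hgz0 : -pot t c δ z0 / ε ≤ g z0 := by
    rw [hg]; dsimp only; gcongr; have : 0 ≤ η * ‖z0‖ ^ 2 := by positivity
    linarith
  have hxR : ‖x‖ ≤ R := mem_closedBall_zero_iff.1 hx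
  have hηx : η * ‖x‖ ^ 2 ≤ 1 := by rw [← hηR]; gcongr
  -- interior
  have hxin : ‖x‖ < R := by
    by_contra hnot
    have hxe : ‖x‖ = R := le_antisymm hxR (not_lt.1 hnot)
    have h1 : Real.log (R - r) ≤ pot t c δ x := by
      refine pot_ge (by linarith) hc hc1 fun w hw => le_max_of_le_left ?_
      have := hr w (ht hw)
      have := norm_sub_norm_le x w
      linarith
    have h2 : (u x).toReal ≤ U := by have := hx1m x hx hxb; simpa using this
    have h3 : g x ≤ (-pot t c δ z0 - 2) / ε := by
      rw [hg]; dsimp only; gcongr; linarith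
    have h4 : (-pot t c δ z0 - 2) / ε = -pot t c δ z0 / ε - 2 * (1 / ε) := by ring
    have h5 : 0 < 1 / ε := by positivity
    linarith
  -- away from K
  have hxK : ∀ a ∈ K, δ < dist x a := by
    intro a ha
    by_contra hnot
    push Not at hnot
    have h1 : x ∈ thickening δ1 K := mem_thickening_iff.2 ⟨a, ha,
      lt_of_le_of_lt hnot (hδlt.trans_le (min_le_left _ _))⟩
    have h2 : u x < ((-T : ℝ) : EReal) := hth h1
    rw [← EReal.coe_toReal (hT x) hxb, EReal.coe_lt_coe_iff] at h2
    have h3 : g x ≤ (M + 1) / ε := by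
      have := hcon x
      rw [hg]; dsimp only; gcongr; linarith
    have h4 : -Real.log L / ε ≤ -pot t c δ z0 / ε := by gcongr
    have h5 : -Real.log L / ε = -(Real.log L / ε) := by ring
    linarith
  -- a small disc
  have hcl : IsOpen {z : ℂ | ∀ w ∈ t, δ < ‖z - w‖} := by
    have : {z : ℂ | ∀ w ∈ t, δ < ‖z - w‖} = ⋂ w ∈ t, {z : ℂ | δ < ‖z - w‖} := by
      ext; simp
    rw [this]
    exact isOpen_biInter_finset fun w _ => isOpen_lt continuous_const (by fun_prop)
  obtain ⟨ρ, hρ, hball⟩ := Metric.isOpen_iff.1 (hcl.inter (isOpen_ball (x := (0:ℂ)) (ε := R))) x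
    ⟨fun w hw => by rw [← dist_eq_norm]; exact hxK w (ht hw), mem_ball_zero_iff.2 hxin⟩
  set s := ρ / 2 with hs
  have hs0 : 0 < s := by positivity
  have hsub : closedBall x s ⊆ ball x ρ := closedBall_subset_ball (by rw [hs]; linarith)
  refine no_strict_max hu hxb hs0 (m := η * s ^ 2 / ε) (k := fun z => (1 / ε) * (-1 * pot t c δ z
    + η * (‖x‖ ^ 2 + s ^ 2 + (2 * ((z - x) * (starRingEnd ℂ) x)).re))) ?_ (by positivity) ?_
  · intro z hz
    refine Supp.const_mul (Supp.add (pot_supp hδ (-1) (hball (hsub hz)).1)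
      (Supp.const_mul (Supp.add (supp_const _ _) ?_) hη0.le)) (by positivity)
    refine ⟨by fun_prop, fun z => 2 * ((z - x) * (starRingEnd ℂ) x), ?_, rfl, by simp⟩
    fun_prop
  · intro z hz hzb
    have h1 := hxm z (ball_subset_closedBall (hball (hsub (sphere_subset_closedBall hz))).2) hzb
    have hzs : ‖z - x‖ = s := by rw [← dist_eq_norm]; exact hz
    have h2 : ‖z‖ ^ 2 = ‖x‖ ^ 2 + s ^ 2 + (2 * ((z - x) * (starRingEnd ℂ) x)).re := by
      rw [← hzs, ← Complex.normSq_eq_norm_sq, ← Complex.normSq_eq_norm_sq,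
        ← Complex.normSq_eq_norm_sq]
      conv_lhs => rw [show z = (z - x) + x by ring, Complex.normSq_add]
      have : (2 * ((z - x) * (starRingEnd ℂ) x)).re = 2 * ((z - x) * (starRingEnd ℂ) x).re := by
        simp [Complex.mul_re]
      rw [this]; ring
    rw [← h2]
    simp only [hg] at h1
    simp only [sub_self, zero_mul, mul_zero, Complex.zero_re, add_zero]
    have e1 : ∀ y : ℝ, y / ε = (1 / ε) * y := fun y => by ring
    have b1 := e1 (-pot t c δ z + η * ‖z‖ ^ 2)
    have b2 := e1 (-pot t c δ x + η * ‖x‖ ^ 2)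
    have b3 := e1 (η * s ^ 2)
    have e2 : (1 / ε) * (-1 * pot t c δ x + η * (‖x‖ ^ 2 + s ^ 2)) - (1 / ε) * (η * s ^ 2) =
      (1 / ε) * (-pot t c δ x + η * ‖x‖ ^ 2) := by ring
    have e3 : (1 / ε) * (-1 * pot t c δ z + η * ‖z‖ ^ 2) =
      (1 / ε) * (-pot t c δ z + η * ‖z‖ ^ 2) := by ring
    linarith

theorem evans {A K : Set ℂ} (hA : PolarSet A) (hKA : K ⊆ A) (hK : IsCompact K) {ρ : ℝ}
    (hρ : 1 ≤ ρ) (hKρ : ∀ a ∈ K, ‖a‖ ≤ ρ) {M : ℝ} :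
    ∃ (v : ℂ → ℝ) (δ : ℝ), 0 < δ ∧ Continuous v ∧ (∀ z, ‖z‖ ≤ ρ → v z ≤ 0) ∧
      (∀ z, (∃ a ∈ K, dist z a ≤ δ) → v z ≤ -M) ∧
      (∀ z, (∀ a ∈ K, δ < dist z a) → Supp v z) ∧
      ∀ z d, 0 < d → d ≤ 1 → (∀ a ∈ K, d ≤ dist z a) → Real.log d - Real.log (2 * ρ) ≤ v z := by
  have hlρ : 0 ≤ Real.log (2 * ρ) := Real.log_nonneg (by linarith)
  rcases K.eq_empty_or_nonempty with rfl | hne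
  · refine ⟨fun _ => 0, 1, one_pos, continuous_const, by simp, by simp, fun z _ => supp_const _ _,
      fun z d hd hd1 _ => ?_⟩
    have := Real.log_nonpos hd.le hd1
    linarith
  obtain ⟨δ0, hδ0, hpol⟩ := polar_pot hA hKA hK (M + Real.log 2 + Real.log 3)
  set δ := min (δ0 / 2) 1 with hδd
  have hδ : 0 < δ := by positivity
  have hδlt : δ < δ0 := (min_le_left _ _).trans_lt (by linarith)
  have hδ1 : δ ≤ 1 := min_le_right _ _
  obtain ⟨t, c, q, ht, hc, hc1, hlow, hup⟩ := equilibrium hK hne hδ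
  obtain ⟨z1, hz1⟩ := hpol δ hδ hδlt t c ht hc hc1
  have hq := hlow z1
  refine ⟨fun z => pot t c δ z - Real.log (2 * ρ), δ, hδ, (pot_continuous hδ).sub continuous_const,
    ?_, ?_, ?_, ?_⟩
  · intro z hz
    have := pot_le (d := 2 * ρ) hδ hc hc1 (z := z) fun w hw => max_le
      ((norm_sub_le _ _).trans (by have := hKρ w (ht hw); linarith)) (by linarith)
    linarith
  · intro z hz
    have := hup z hz
    linarith
  · intro z hz
    have h1 := pot_supp (t := t) (c := c) hδ 1 (z := z) fun w hw => by
      rw [← dist_eq_norm]; exact hz w (ht hw)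
    have h2 := h1.add (supp_const (-Real.log (2 * ρ)) z)
    exact h2.congr (Eventually.of_forall fun y => by ring)
  · intro z d hd _ hz
    have := pot_ge (δ := δ) hd hc hc1 (z := z) fun w hw => le_max_of_le_left (by
      rw [← dist_eq_norm]; exact hz w (ht hw))
    linarith

theorem xlogx_ge {x a : ℝ} (hx : 0 ≤ x) (ha : 0 < a) :
    x * Real.log a + x - a ≤ x * Real.log x := by
  rcases hx.eq_or_lt with rfl | hx
  · simp; exact ha.le
  · have := Real.log_le_sub_one_of_pos (show 0 < a / x by positivity)
    rw [Real.log_div ha.ne' hx.ne'] at this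
    have h2 := mul_le_mul_of_nonneg_left this hx.le
    have h3 : x * (a / x - 1) = a - x := by field_simp
    nlinarith

theorem proj_est {b : ℂ} {r δ Q : ℝ} {t : Finset ℂ} {c : ℂ → ℝ} (hr : 0 < r) (hδ : 0 < δ)
    (ht : ∀ w ∈ t, r / 2 ≤ ‖w - b‖ ∧ ‖w - b‖ ≤ r) (hc : ∀ w, 0 ≤ c w) (h1 : ∑ w ∈ t, c w = 1)
    (hs : ∀ s, r / 2 ≤ s → s ≤ r → ∃ z, ‖z - b‖ = s ∧ pot t c δ z ≤ Q) :
    Real.log r - Real.log 4 - 1 ≤ Q := by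
  have hG : ∀ s, r / 2 ≤ s → s ≤ r → ∑ w ∈ t, c w * Real.log (max |s - ‖w - b‖| δ) ≤ Q := by
    intro s h2 h3
    obtain ⟨z, hz, hzQ⟩ := hs s h2 h3
    refine le_trans (Finset.sum_le_sum fun w hw => ?_) hzQ
    refine mul_le_mul_of_nonneg_left (Real.log_le_log (lt_max_of_lt_right hδ) ?_) (hc w)
    apply max_le_max_right
    rw [← hz]
    have := abs_norm_sub_norm_le (z - b) (w - b)
    simpa using this
  have hci : ∀ ρ : ℝ, Continuous fun s : ℝ => Real.log (max |s - ρ| δ) := by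
    intro ρ
    exact Continuous.log (by fun_prop) fun s => (lt_max_of_lt_right hδ).ne'
  have hr2 : r / 2 ≤ r := by linarith
  have hIntg : ∫ s in (r / 2)..r, ∑ w ∈ t, c w * Real.log (max |s - ‖w - b‖| δ) ≤ (r / 2) * Q := by
    have h2 : ∫ s in (r / 2)..r, ∑ w ∈ t, c w * Real.log (max |s - ‖w - b‖| δ) ≤
        ∫ s in (r / 2)..r, Q := by
      apply intervalIntegral.integral_mono_on hr2
      · apply Continuous.intervalIntegrable
        exact continuous_finsetSum _ fun w _ => continuous_const.mul (hci _)
      · exact intervalIntegrable_const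
      · intro s hs; exact hG s hs.1 hs.2
    rw [intervalIntegral.integral_const, smul_eq_mul] at h2
    linarith
  rw [intervalIntegral.integral_finsetSum (f := fun w s => c w * Real.log (max |s - ‖w - b‖| δ))
    (fun w _ => ((continuous_const.mul (hci _)).intervalIntegrable _ _))] at hIntg
  have hone : ∀ w ∈ t, c w * ((r / 2) * (Real.log (r / 4) - 1)) ≤
      ∫ s in (r / 2)..r, c w * Real.log (max |s - ‖w - b‖| δ) := by
    intro w hw
    rw [intervalIntegral.integral_const_mul]
    refine mul_le_mul_of_nonneg_left ?_ (hc w)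
    obtain ⟨hw1, hw2⟩ := ht w hw
    set ρ := ‖w - b‖ with hρ
    have h2 : ∫ s in (r / 2)..r, Real.log (s - ρ) ≤
        ∫ s in (r / 2)..r, Real.log (max |s - ρ| δ) := by
      apply intervalIntegral.integral_mono_ae hr2
      · have : IntervalIntegrable Real.log volume (r / 2 - ρ) (r - ρ) :=
          intervalIntegral.intervalIntegrable_log'
        simpa using this.comp_sub_right ρ
      · exact (hci ρ).intervalIntegrable _ _
      · have : ∀ᵐ s : ℝ, s ∉ ({ρ} : Set ℝ) := (countable_singleton ρ).ae_notMem volume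
        filter_upwards [this] with s hs
        have hne : s - ρ ≠ 0 := fun h => hs (by simp; linarith)
        rw [← Real.log_abs]
        exact Real.log_le_log (abs_pos.2 hne) (le_max_left _ _)
    refine le_trans ?_ h2
    rw [intervalIntegral.integral_comp_sub_right (fun x => Real.log x), integral_log]
    have h3 := xlogx_ge (x := r - ρ) (a := r / 4) (by linarith) (by positivity)
    have h4 := xlogx_ge (x := ρ - r / 2) (a := r / 4) (by linarith) (by positivity)
    have h5 : Real.log (r / 2 - ρ) = Real.log (ρ - r / 2) := by
      rw [← Real.log_neg_eq_log]; congr 1; ring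
    rw [h5]
    linarith
  have := (Finset.sum_le_sum hone).trans hIntg
  rw [← Finset.sum_mul, h1, one_mul, Real.log_div hr.ne' (by norm_num)] at this
  have h6 : 0 < r / 2 := by positivity
  have := le_of_mul_le_mul_left this h6
  linarith

theorem polar_not_ball {A : Set ℂ} (hA : PolarSet A) {b : ℂ} {r : ℝ} (hr : 0 < r) :
    ¬ closedBall b r ⊆ A := by
  intro hsub
  set K := closedBall b r ∩ {z | r / 2 ≤ ‖z - b‖} with hKd
  have hK : IsCompact K := (isCompact_closedBall b r).inter_right
    (isClosed_le continuous_const (by fun_prop))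
  have hmem : ∀ s, r / 2 ≤ s → s ≤ r → ∃ z ∈ K, ‖z - b‖ = s := by
    intro s h1 h2
    have : ‖(b + (s : ℂ)) - b‖ = s := by simp; linarith
    refine ⟨b + s, ⟨?_, ?_⟩, this⟩
    · rw [mem_closedBall, dist_eq_norm, this]; exact h2
    · show r / 2 ≤ ‖b + (s : ℂ) - b‖
      rw [this]; exact h1
  obtain ⟨zz, hzz, -⟩ := hmem r (by linarith) le_rfl
  obtain ⟨δ0, hδ0, hpol⟩ := polar_pot hA (inter_subset_left.trans hsub) hK
    (-(Real.log r - Real.log 4 - 1 - Real.log 3 - Real.log 2))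
  obtain ⟨t, c, q, ht, hc, hc1, hlow, hup⟩ := equilibrium hK ⟨zz, hzz⟩ (half_pos hδ0)
  obtain ⟨z1, hz1⟩ := hpol (δ0 / 2) (by positivity) (by linarith) t c ht hc hc1
  have h1 := proj_est (b := b) (Q := q + Real.log 3) hr (half_pos hδ0) (fun w hw => by
    have := ht hw
    exact ⟨this.2, by rw [← dist_eq_norm]; exact this.1⟩) hc hc1 (fun s h1 h2 => by
    obtain ⟨z, hz, hzs⟩ := hmem s h1 h2
    exact ⟨z, hzs, hup z ⟨z, hz, by rw [dist_self]; positivity⟩⟩)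
  have := hlow z1
  linarith

/-- exhaustion function of a plane domain -/
noncomputable def psi (D : Set ℂ) (z : ℂ) : ℝ :=
  max (-Real.log (infDist z Dᶜ)) (Real.log (max 1 ‖z‖))

/-- exhaustion function of `D × ℂ` -/
noncomputable def chi (D : Set ℂ) (p : ℂ × ℂ) : ℝ :=
  max (psi D p.1) (Real.log (max 1 ‖p.2‖))

theorem logmax_supp (z : ℂ) : Supp (fun z : ℂ => Real.log (max 1 ‖z‖)) z := by
  have h1 : ∀ z : ℂ, Real.log (max 1 ‖z‖) = max 0 (Real.log (max 1 ‖z‖)) := fun z =>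
    (max_eq_right (Real.log_nonneg (le_max_left _ _))).symm
  have hc : Continuous (fun z : ℂ => Real.log (max 1 ‖z‖)) :=
    Continuous.log (by fun_prop) fun z => (lt_max_of_lt_left one_pos).ne'
  refine Supp.congr (Supp.max' (supp_const 0 z) hc.continuousAt ?_) (Eventually.of_forall h1)
  intro hz
  have hz1 : 1 < ‖z‖ := by
    by_contra h
    rw [max_eq_left (not_lt.1 h)] at hz
    simp at hz
  refine Supp.congr (supp_log (F := fun z => z) analyticAt_id
    (norm_pos_iff.1 (one_pos.trans hz1)) 1) ?_
  have : ContinuousAt (fun z : ℂ => ‖z‖) z := by fun_prop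
  filter_upwards [this.eventually_const_lt hz1] with y hy
  rw [max_eq_right hy.le, one_mul]

theorem psi_supp {D : Set ℂ} (hD : IsOpen D) {z : ℂ} (hz : z ∈ D) : Supp (psi D) z := by
  refine Supp.max ?_ (logmax_supp z)
  rcases (Dᶜ).eq_empty_or_nonempty with h | h
  · rw [h]; simpa using supp_const 0 z
  · have hcl : IsClosed Dᶜ := hD.isClosed_compl
    have hpos : ∀ y ∈ D, 0 < infDist y Dᶜ := fun y hy =>
      (hcl.notMem_iff_infDist_pos h).1 (by simpa using hy)
    obtain ⟨a, ha, hdist⟩ := hcl.exists_infDist_eq_dist h z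
    have hza : z - a ≠ 0 := by
      rw [sub_ne_zero]; rintro rfl; exact ha hz
    obtain ⟨-, Φ, h1, h2, h3⟩ := supp_log (F := fun y => y - a) (p := z)
      (analyticAt_id.fun_sub analyticAt_const) hza (-1)
    refine ⟨?_, Φ, h1, ?_, ?_⟩
    · exact ((continuous_infDist_pt _).continuousAt.log (hpos z hz).ne').neg
    · rw [h2]; beta_reduce; rw [hdist, dist_eq_norm]; ring
    · filter_upwards [h3, hD.mem_nhds hz] with y hy hyD
      refine hy.trans ?_
      have := Real.log_le_log (hpos y hyD) (infDist_le_dist_of_mem ha)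
      rw [dist_eq_norm] at this
      linarith

theorem chi_supp {D : Set ℂ} (hD : IsOpen D) {p : ℂ × ℂ} (hp : p.1 ∈ D) : Supp (chi D) p := by
  refine Supp.max ?_ ?_
  · exact Supp.comp (F := fun p : ℂ × ℂ => p.1) (psi_supp hD hp) analyticAt_fst
  · exact Supp.comp (F := fun p : ℂ × ℂ => p.2) (logmax_supp p.2) analyticAt_snd

theorem logmax_le {w : ℂ} {s : ℝ} (h : Real.log (max 1 ‖w‖) ≤ s) : ‖w‖ ≤ Real.exp s := by
  rw [Real.log_le_iff_le_exp (lt_max_of_lt_left one_pos)] at h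
  exact (le_max_right _ _).trans h

theorem psi_compact {D : Set ℂ} (hD : IsOpen D) (s : ℝ) : IsCompact {z | z ∈ D ∧ psi D z ≤ s} := by
  refine isCompact_of_isClosed_isBounded ?_ ?_
  · rcases (Dᶜ).eq_empty_or_nonempty with h | h
    · have hu : D = univ := compl_empty_iff.1 h
      have : {z | z ∈ D ∧ psi D z ≤ s} = {z | psi D z ≤ s} := by ext z; simp [hu]
      rw [this]
      refine isClosed_le ?_ continuous_const
      rw [continuous_iff_continuousAt]
      intro z
      exact (psi_supp hD (by rw [hu]; trivial)).1
    · have : {z | z ∈ D ∧ psi D z ≤ s} = {z | Real.exp (-s) ≤ infDist z Dᶜ} ∩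
          {z | Real.log (max 1 ‖z‖) ≤ s} := by
        have hcl : IsClosed Dᶜ := hD.isClosed_compl
        ext z
        have hpos : z ∈ D ↔ 0 < infDist z Dᶜ := by
          rw [← hcl.notMem_iff_infDist_pos h]; simp
        simp only [mem_ofPred_eq, psi, max_le_iff, mem_inter_iff, hpos]
        constructor
        · rintro ⟨h1, h2, h3⟩
          refine ⟨?_, h3⟩
          rw [← Real.le_log_iff_exp_le h1]; linarith
        · rintro ⟨h1, h2⟩
          have h3 := (Real.exp_pos (-s)).trans_le h1
          refine ⟨h3, ?_, h2⟩
          rw [← Real.le_log_iff_exp_le h3] at h1; linarith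
      rw [this]
      refine (isClosed_le continuous_const (continuous_infDist_pt _)).inter (isClosed_le ?_ continuous_const)
      exact Continuous.log (by fun_prop) fun z => (lt_max_of_lt_left one_pos).ne'
  · refine (isBounded_closedBall (x := (0:ℂ)) (r := Real.exp s)).subset ?_
    rintro z ⟨-, hz⟩
    rw [mem_closedBall_zero_iff]
    exact logmax_le ((le_max_right _ _).trans hz)

theorem chi_bdd {D : Set ℂ} (hD : IsOpen D) {K : Set (ℂ × ℂ)} (hK : IsCompact K)
    (hKD : ∀ p ∈ K, p.1 ∈ D) : ∃ J : ℕ, ∀ j ≥ J, ∀ p ∈ K, chi D p ≤ (j : ℝ) := by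
  have : ContinuousOn (chi D) K := fun p hp => (chi_supp hD (hKD p hp)).1.continuousWithinAt
  obtain ⟨C, hC⟩ := (hK.image_of_continuousOn this).bddAbove
  obtain ⟨J, hJ⟩ := exists_nat_ge C
  refine ⟨J, fun j hj p hp => ?_⟩
  have h1 := hC (mem_image_of_mem _ hp)
  have h2 : (J : ℝ) ≤ j := by exact_mod_cast hj
  linarith

theorem logmax_supp' {E : Type*} [NormedAddCommGroup E] [NormedSpace ℂ E] {F : E → ℂ} {p : E}
    (hF : AnalyticAt ℂ F p) {κ : ℝ} (hκ : 0 < κ) :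
    Supp (fun q => Real.log (max ‖F q‖ κ)) p := by
  have h1 : ∀ q, Real.log (max ‖F q‖ κ) = max (Real.log κ) (Real.log (max ‖F q‖ κ)) := fun q =>
    (max_eq_right (Real.log_le_log hκ (le_max_right _ _))).symm
  have hc : ContinuousAt (fun q => Real.log (max ‖F q‖ κ)) p := by
    refine ContinuousAt.log ?_ (lt_max_of_lt_right hκ).ne'
    have := hF.continuousAt
    fun_prop
  refine Supp.congr (Supp.max' (supp_const (Real.log κ) p) hc ?_) (Eventually.of_forall h1)
  intro hz
  have hz1 : κ < ‖F p‖ := by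
    by_contra h
    rw [max_eq_right (not_lt.1 h)] at hz
    exact lt_irrefl _ hz
  refine Supp.congr (supp_log hF (norm_pos_iff.1 (hκ.trans hz1)) 1) ?_
  have : ContinuousAt (fun q => ‖F q‖) p := hF.continuousAt.norm
  filter_upwards [this.eventually_const_lt hz1] with y hy
  rw [max_eq_left hy.le, one_mul]

theorem isOpen_diff_of {D A : Set ℂ} (hD : IsOpen D) (hAcl : ∀ z ∈ D, z ∈ closure A → z ∈ A) :
    IsOpen (D \ A) := by
  have : D \ A = D \ closure A := by
    ext z
    constructor
    · rintro ⟨h1, h2⟩; exact ⟨h1, fun h => h2 (hAcl z h1 h)⟩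
    · rintro ⟨h1, h2⟩; exact ⟨h1, fun h => h2 (subset_closure h)⟩
  rw [this]
  exact hD.sdiff isClosed_closure

open Classical in
theorem glue {D A : Set ℂ} {f : ℂ → ℂ} (hD : IsOpen D)
    (hAcl : ∀ z ∈ D, z ∈ closure A → z ∈ A) (hApol : PolarSet A)
    (hf : DifferentiableOn ℂ f (D \ A)) (j : ℕ) {ε b d0 : ℝ} (hε : 0 < ε) (hb : 0 < b)
    (hd0 : 0 < d0) (β : ℂ → ℝ) (Z O : Set ℂ) (hZ : IsClosed Z) (hO : IsOpen O) (hZO : Z ⊆ O)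
    (hOD : O ⊆ D \ A) (hOf : ∀ z ∈ O, Real.exp (j + 2) + 1 ≤ ‖f z‖)
    (hOd : ∀ z ∈ O, ∀ a ∈ A, d0 ≤ dist z a)
    (hβ : ∀ z, z ∉ Z → Supp β z)
    (hβε : ∀ z ∈ D, psi D z ≤ j + 2 → z ∉ Z → β z ≤ -ε)
    (hβb : ∀ z ∈ D, psi D z ≤ j + 2 → -b ≤ β z)
    {L : Set (ℂ × ℂ)} (hL : IsCompact L) (hLO : ∀ p ∈ L, p.1 ∈ D \ A ∧ p.2 ≠ f p.1) :
    ∃ h : ℂ × ℂ → ℝ, (∀ p, p.1 ∈ D → Supp h p) ∧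
      (∀ p, p.1 ∈ D → chi D p ≤ j → h p ≤ 0) ∧
      (∀ z ∈ D \ A, chi D (z, f z) ≤ j → h (z, f z) ≤ max (-1) (β z)) ∧
      (∀ p, p.1 ∈ D → p.1 ∈ A → chi D p ≤ j → h p ≤ max (-1) (β p.1) ∧ β p.1 ≤ h p) ∧
      ∀ p ∈ L, chi D p ≤ j → -ε ≤ h p := by
  set R := Real.exp (j + 2) with hR
  have hR1 : 1 ≤ R := Real.one_le_exp (by positivity)
  have hopen : IsOpen (D \ A) := isOpen_diff_of hD hAcl
  have hfan : ∀ z ∈ D \ A, AnalyticAt ℂ f z := fun z hz => hf.analyticAt (hopen.mem_nhds hz)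
  set D2 := {z | z ∈ D ∧ psi D z ≤ j + 2} with hD2
  have hD2c : IsCompact D2 := psi_compact hD _
  have hD2R : ∀ z ∈ D2, ‖z‖ ≤ R := fun z hz => logmax_le ((le_max_right _ _).trans hz.2)
  -- separation on L
  obtain ⟨η1, hη1, hLa⟩ : ∃ a', 0 < a' ∧ ∀ p ∈ L, a' ≤ ‖p.2 - f p.1‖ := by
    refine hL.exists_forall_le' (f := fun p : ℂ × ℂ => ‖p.2 - f p.1‖) ?_ ?_
    · intro p hp
      have h1 : ContinuousAt (fun p : ℂ × ℂ => f p.1) p :=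
        ContinuousAt.comp' (f := fun p : ℂ × ℂ => p.1) (hfan p.1 (hLO p hp).1).continuousAt
          continuousAt_fst
      exact (continuousAt_snd.sub h1).norm.continuousWithinAt
    · intro p hp
      exact norm_pos_iff.2 (sub_ne_zero.2 (hLO p hp).2)
  obtain ⟨η2, hη2, hLb⟩ := (hL.image continuous_fst).exists_thickening_subset_open
    (isClosed_closure (s := A)).isOpen_compl (by
      rintro _ ⟨p, hp, rfl⟩ hcl
      exact (hLO p hp).1.2 (hAcl _ (hLO p hp).1.1 hcl))
  have hη2' : ∀ p ∈ L, ∀ a ∈ A, η2 ≤ dist p.1 a := by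
    intro p hp a ha
    by_contra hlt
    push Not at hlt
    exact hLb (mem_thickening_iff.2 ⟨p.1, mem_image_of_mem _ hp, by rw [dist_comm]; exact hlt⟩)
      (subset_closure ha)
  obtain ⟨η, hη0, hη_1, hηd, hηη1, hηη2⟩ : ∃ η : ℝ, 0 < η ∧ η ≤ 1 ∧ η ≤ d0 ∧ η ≤ η1 ∧ η ≤ η2 :=
    ⟨min (min 1 d0) (min η1 η2), by positivity, by simp, by simp, by simp, by simp⟩
  set m := Real.log (2 * R) - Real.log η with hm
  have hlogη : Real.log η ≤ 0 := Real.log_nonpos hη0.le hη_1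
  have hm0 : 0 ≤ m := by
    have : 0 ≤ Real.log (2 * R) := Real.log_nonneg (by linarith)
    linarith
  set M := m + 2 + 2 * b * m / ε with hM
  have hM' : 0 ≤ 2 * b * m / ε := by positivity
  set s := b / (M - 1) with hs
  have hM1 : 0 < M - 1 := by linarith
  have hs0 : 0 < s := by positivity
  have hsM : s * (M - 1) = b := by rw [hs]; field_simp
  have hsm : s * m ≤ ε / 2 := by
    rw [hs, div_mul_eq_mul_div, div_le_iff₀ hM1]
    have : ε * (2 * b * m / ε) = 2 * b * m := by field_simp
    nlinarith
  have hKA : IsCompact (A ∩ D2) := by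
    have : A ∩ D2 = closure A ∩ D2 := by
      ext z
      constructor
      · rintro ⟨h1, h2⟩; exact ⟨subset_closure h1, h2⟩
      · rintro ⟨h1, h2⟩; exact ⟨hAcl z h2.1 h1, h2⟩
    rw [this]; exact hD2c.inter_left isClosed_closure
  obtain ⟨v, δ, hδ, hvc, hv0, hvK, hvS, hvd⟩ := evans hApol (inter_subset_left (t := D2)) hKA hR1
    (fun a ha => hD2R a ha.2) (M := M + 1)
  have hvη : ∀ z, (∀ a ∈ A, η ≤ dist z a) → -M < v z := by
    intro z hz
    have := hvd z η hη0 hη_1 (fun a ha => hz a ha.1)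
    linarith
  have hvη' : ∀ z, (∀ a ∈ A, η ≤ dist z a) → -(s * m) ≤ s * v z := by
    intro z hz
    have := hvd z η hη0 hη_1 (fun a ha => hz a ha.1)
    nlinarith
  have hvA : ∀ z ∈ D2, -M ≤ v z → z ∈ D \ A := by
    intro z hz hv
    refine ⟨hz.1, fun hA => ?_⟩
    have := hvK z ⟨z, ⟨hA, hz⟩, by simp [hδ.le]⟩
    linarith
  have hvS' : ∀ z, -M ≤ v z → Supp v z := by
    intro z hz
    refine hvS z fun a ha => ?_
    by_contra hlt
    have := hvK z ⟨a, ha, not_lt.1 hlt⟩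
    linarith
  -- bound of f
  obtain ⟨B, hB0, hB⟩ : ∃ B : ℝ, 0 ≤ B ∧ ∀ z ∈ D2, -M ≤ v z → ‖f z‖ ≤ B := by
    have hc : IsCompact (D2 ∩ {z | -M ≤ v z}) :=
      hD2c.inter_right (isClosed_le continuous_const hvc)
    obtain ⟨C, hC⟩ := hc.exists_bound_of_continuousOn (f := f)
      (hf.continuousOn.mono fun z hz => hvA z hz.1 hz.2)
    exact ⟨max C 0, le_max_right _ _, fun z h1 h2 => (hC z ⟨h1, h2⟩).trans (le_max_left _ _)⟩
  have hRB : 0 < R + B := by linarith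
  set T := Real.log (R + B) - Real.log η with hT
  have hT0 : 0 ≤ T := by
    have : 0 ≤ Real.log (R + B) := Real.log_nonneg (by linarith)
    linarith
  set δ' := ε / (2 * (T + 1)) with hδ'
  have hδ'0 : 0 < δ' := by positivity
  have hδ'T : δ' * T ≤ ε / 2 := by
    rw [hδ', div_mul_eq_mul_div, div_le_div_iff₀ (by positivity) (by norm_num)]
    nlinarith
  set κ := Real.exp (-b / δ') with hκ
  have hκ0 : 0 < κ := Real.exp_pos _
  have hκ1 : κ ≤ 1 := Real.exp_le_one_iff.2 (div_nonpos_of_nonpos_of_nonneg (by linarith) hδ'0.le)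
  have hκl : δ' * Real.log κ = -b := by rw [hκ, Real.log_exp]; field_simp
  set H : ℂ × ℂ → ℝ := fun p => δ' * Real.log (max ‖(p.2 - f p.1) / ((R + B : ℝ) : ℂ)‖ κ) + s * v p.1
    with hH
  have hnorm : ∀ x : ℂ, ‖x / ((R + B : ℝ) : ℂ)‖ = ‖x‖ / (R + B) := by
    intro x
    rw [norm_div, Complex.norm_real, Real.norm_of_nonneg hRB.le]
  -- upper bound of the log part
  have hlog0 : ∀ p : ℂ × ℂ, p.1 ∈ D2 → -M ≤ v p.1 → ‖p.2‖ ≤ R →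
      δ' * Real.log (max ‖(p.2 - f p.1) / ((R + B : ℝ) : ℂ)‖ κ) ≤ 0 := by
    intro p h1 h2 h3
    apply mul_nonpos_of_nonneg_of_nonpos hδ'0.le
    apply Real.log_nonpos (le_max_of_le_right hκ0.le)
    refine max_le ?_ hκ1
    rw [hnorm, div_le_one hRB]
    exact (norm_sub_le _ _).trans (add_le_add h3 (hB _ h1 h2))
  have hHle : ∀ p : ℂ × ℂ, p.1 ∈ D2 → -M ≤ v p.1 → ‖p.2‖ ≤ R → H p ≤ s * v p.1 := by
    intro p h1 h2 h3
    have := hlog0 p h1 h2 h3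
    simp only [hH]; linarith
  have hH0 : ∀ p : ℂ × ℂ, p.1 ∈ D2 → -M ≤ v p.1 → ‖p.2‖ ≤ R → H p ≤ 0 := by
    intro p h1 h2 h3
    have h4 := hv0 p.1 (hD2R _ h1)
    have := hHle p h1 h2 h3
    nlinarith
  have hHlow : ∀ p : ℂ × ℂ, (∀ a ∈ A, η ≤ dist p.1 a) → η ≤ ‖p.2 - f p.1‖ → -ε ≤ H p := by
    intro p h1 h2
    have h3 := hvη' p.1 h1
    have h4 : -T ≤ Real.log (max ‖(p.2 - f p.1) / ((R + B : ℝ) : ℂ)‖ κ) := by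
      have : -T = Real.log (η / (R + B)) := by rw [Real.log_div hη0.ne' hRB.ne']; ring
      rw [this]
      refine Real.log_le_log (by positivity) (le_max_of_le_left ?_)
      rw [hnorm]; gcongr
    have h5 := mul_le_mul_of_nonneg_left h4 hδ'0.le
    simp only [hH]
    linarith
  have hHS : ∀ p : ℂ × ℂ, p.1 ∈ D2 → -M ≤ v p.1 → Supp H p := by
    intro p h1 h2
    refine Supp.add (Supp.const_mul (logmax_supp' ?_ hκ0) hδ'0.le)
      (Supp.const_mul (Supp.comp (F := fun p : ℂ × ℂ => p.1) (hvS' p.1 h2) analyticAt_fst) hs0.le)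
    have h3 : AnalyticAt ℂ (fun p : ℂ × ℂ => f p.1) p :=
      AnalyticAt.fun_comp (f := fun p : ℂ × ℂ => p.1) (hfan p.1 (hvA p.1 h1 h2)) analyticAt_fst
    have h4 : ((R + B : ℝ) : ℂ) ≠ 0 := by exact_mod_cast hRB.ne'
    exact (analyticAt_snd.fun_sub h3).fun_div analyticAt_const h4
  have hOv : ∀ z ∈ O, -M < v z := fun z hz => hvη z fun a ha => hηd.trans (hOd z hz a ha)
  have hOH : ∀ p : ℂ × ℂ, p.1 ∈ O → ‖p.2‖ ≤ R → -ε ≤ H p := by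
    intro p h1 h2
    refine hHlow p (fun a ha => hηd.trans (hOd _ h1 a ha)) (hη_1.trans ?_)
    have h3 := hOf _ h1
    have h4 := norm_sub_norm_le (f p.1) p.2
    rw [norm_sub_rev] at h4
    linarith
  set k : ℂ × ℂ → ℝ := fun p => if p.1 ∈ Z then H p else if v p.1 ≤ -M then β p.1 else
    max (β p.1) (H p) with hk
  have hchi : ∀ p : ℂ × ℂ, p.1 ∈ D → chi D p ≤ j + 2 → p.1 ∈ D2 ∧ ‖p.2‖ ≤ R := by
    intro p h1 h2
    exact ⟨⟨h1, (le_max_left _ _).trans h2⟩, logmax_le ((le_max_right _ _).trans h2)⟩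
  have hk0 : ∀ p : ℂ × ℂ, p.1 ∈ D → chi D p ≤ j + 2 → k p ≤ 0 := by
    intro p h1 h2
    obtain ⟨h3, h4⟩ := hchi p h1 h2
    simp only [hk]
    split_ifs with h5 h6
    · exact hH0 p h3 (hOv _ (hZO h5)).le h4
    · have := hβε _ h1 h3.2 h5; linarith
    · refine max_le ?_ (hH0 p h3 (not_le.1 h6).le h4)
      have := hβε _ h1 h3.2 h5; linarith
  have hkβ : ∀ p : ℂ × ℂ, p.1 ∈ D → chi D p ≤ j + 2 → p.1 ∉ Z → v p.1 < -M + 1 → k p = β p.1 := by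
    intro p h1 h2 h5 h6
    obtain ⟨h3, h4⟩ := hchi p h1 h2
    simp only [hk, if_neg h5]
    split_ifs with h7
    · rfl
    · apply max_eq_left
      have h8 := hHle p h3 (not_le.1 h7).le h4
      have h9 := hβb _ h1 h3.2
      nlinarith
  set h : ℂ × ℂ → ℝ := fun p => if chi D p < j + 2 then max (chi D p - (j + 1)) (k p) else
    chi D p - (j + 1) with hh
  have hhj : ∀ p, chi D p ≤ j → h p = max (chi D p - (j + 1)) (k p) := by
    intro p hp
    simp only [hh]
    rw [if_pos (by linarith)]
  refine ⟨h, ?_, ?_, ?_, ?_, ?_⟩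
  · intro p hp
    have hχ := chi_supp hD hp
    have hX : Supp (fun p => chi D p - (j + 1)) p :=
      (hχ.add (supp_const (-((j : ℝ) + 1)) p)).congr (Eventually.of_forall fun q => by ring)
    have hDn : ∀ᶠ q : ℂ × ℂ in 𝓝 p, q.1 ∈ D :=
      continuousAt_fst.eventually (hD.mem_nhds hp)
    by_cases hc : (j : ℝ) + 1 < chi D p
    · refine hX.congr ?_
      filter_upwards [hDn, hχ.1.eventually_const_lt hc] with q hq1 hq2
      simp only [hh]
      split_ifs with h1
      · apply max_eq_left
        have := hk0 q hq1 h1.le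
        linarith
      · rfl
    · have hc2 : chi D p < j + 2 := by linarith
      have hlt : ∀ᶠ q in 𝓝 p, chi D q < j + 2 := hχ.1.eventually_lt_const hc2
      obtain ⟨h3, h4⟩ := hchi p hp hc2.le
      suffices hks : Supp k p by
        refine (hX.max hks).congr ?_
        filter_upwards [hlt] with q hq
        simp only [hh, if_pos hq]
      by_cases hzO : p.1 ∈ O
      · refine (hHS p h3 (hOv _ hzO).le).congr ?_
        have hOn : ∀ᶠ q : ℂ × ℂ in 𝓝 p, q.1 ∈ O := continuousAt_fst.eventually (hO.mem_nhds hzO)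
        filter_upwards [hlt, hOn, hDn] with q hq1 hq2 hq3
        obtain ⟨h5, h6⟩ := hchi q hq3 hq1.le
        simp only [hk]
        split_ifs with h7 h8
        · rfl
        · exact absurd (hOv _ hq2) (not_lt.2 h8)
        · apply max_eq_right
          exact (hβε _ hq3 h5.2 h7).trans (hOH q hq2 h6)
      · have hzZ : p.1 ∉ Z := fun h => hzO (hZO h)
        have hZn : ∀ᶠ q : ℂ × ℂ in 𝓝 p, q.1 ∉ Z :=
          continuousAt_fst.eventually (hZ.isOpen_compl.mem_nhds hzZ)
        have hvcont : ContinuousAt (fun q : ℂ × ℂ => v q.1) p :=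
          (hvc.comp continuous_fst).continuousAt
        have hβS : Supp (fun q : ℂ × ℂ => β q.1) p :=
          Supp.comp (F := fun p : ℂ × ℂ => p.1) (hβ p.1 hzZ) analyticAt_fst
        by_cases hvM : -M < v p.1
        · refine (hβS.max (hHS p h3 hvM.le)).congr ?_
          filter_upwards [hZn, hvcont.eventually_const_lt hvM] with q hq1 hq2
          simp only [hk, if_neg hq1, if_neg (not_le.2 hq2)]
        · refine hβS.congr ?_
          filter_upwards [hZn, hvcont.eventually_lt_const (show v p.1 < -M + 1 by linarith),
            hlt, hDn] with q hq1 hq2 hq3 hq4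
          exact hkβ q hq4 hq3.le hq1 hq2
  · intro p hp hc
    rw [hhj p hc]
    exact max_le (by linarith) (hk0 p hp (by linarith))
  · intro z hz hc
    rw [hhj _ hc]
    obtain ⟨h3, h4⟩ := hchi (z, f z) hz.1 (by linarith)
    have hzZ : z ∉ Z := by
      intro hzZ
      have := hOf z (hZO hzZ)
      simp only at h4
      linarith
    refine max_le (le_max_of_le_left (by linarith)) (le_max_of_le_right ?_)
    simp only [hk, if_neg hzZ]
    split_ifs with h5
    · exact le_rfl
    · refine max_le le_rfl ?_
      have h6 := hv0 z (hD2R _ h3)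
      have h7 := hβb z hz.1 h3.2
      simp only [hH, sub_self, zero_div, norm_zero, max_eq_right hκ0.le, hκl]
      nlinarith
  · intro p hp hpA hc
    rw [hhj _ hc]
    obtain ⟨h3, h4⟩ := hchi p hp (by linarith)
    have hzZ : p.1 ∉ Z := fun hzZ => (hOD (hZO hzZ)).2 hpA
    have hvp : v p.1 < -M + 1 := by
      have := hvK p.1 ⟨p.1, ⟨hpA, h3⟩, by simp [hδ.le]⟩
      linarith
    rw [hkβ p hp (by linarith) hzZ hvp]
    exact ⟨max_le_max_right _ (by linarith), le_max_right _ _⟩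
  · intro p hpL hc
    rw [hhj _ hc]
    apply le_max_of_le_right
    have h1 : ∀ a ∈ A, η ≤ dist p.1 a := fun a ha => hηη2.trans (hη2' p hpL a ha)
    have h2 := hHlow p h1 (hηη1.trans (hLa p hpL))
    simp only [hk]
    split_ifs with h5 h6
    · exact h2
    · exact absurd (hvη _ h1) (not_lt.2 h6)
    · exact le_max_of_le_right h2

theorem annulus_open (b : ℂ) (s t : ℝ) : IsOpen {w : ℂ | s < ‖w - b‖ ∧ ‖w - b‖ < t} :=
  IsOpen.and (isOpen_lt (by fun_prop) (by fun_prop)) (isOpen_lt (by fun_prop) (by fun_prop))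

theorem annulus_closed (b : ℂ) (s t : ℝ) : IsClosed {w : ℂ | s ≤ ‖w - b‖ ∧ ‖w - b‖ ≤ t} :=
  IsClosed.and (isClosed_le (by fun_prop) (by fun_prop)) (isClosed_le (by fun_prop) (by fun_prop))

theorem big_circles {f : ℂ → ℂ} {b : ℂ} {ρ R : ℝ} (hρ : 0 < ρ)
    (hf : DifferentiableOn ℂ f (ball b ρ \ {b}))
    (hno : ∀ s, 0 < s → s ≤ ρ → ¬ ∃ g : ℂ → ℂ, DifferentiableOn ℂ g (ball b s) ∧
      EqOn f g (ball b s \ {b})) :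
    ∃ ρ0 > 0, ρ0 ≤ ρ ∧ ∀ s, 0 < s → s ≤ ρ0 → ∃ z, ‖z - b‖ = s ∧ R ≤ ‖f z‖ := by
  by_contra hcon
  have hc : ∀ ρ0, 0 < ρ0 → ρ0 ≤ ρ → ∃ s, 0 < s ∧ s ≤ ρ0 ∧ ∀ z, ‖z - b‖ = s → ‖f z‖ ≤ R := by
    intro ρ0 h0 h1
    by_contra h2
    refine hcon ⟨ρ0, h0, h1, fun s hs0 hs1 => ?_⟩
    by_contra h3
    push Not at h3
    exact h2 ⟨s, hs0, hs1, fun z hz => (h3 z hz).le⟩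
  obtain ⟨s0, hs0, hs0ρ, hs0R⟩ := hc (ρ / 2) (by positivity) (by linarith)
  have hbd : ∀ z ∈ ball b s0 \ {b}, ‖f z‖ ≤ R := by
    rintro z ⟨hz, hzb⟩
    have hzp : 0 < ‖z - b‖ := norm_pos_iff.2 (sub_ne_zero.2 hzb)
    rw [mem_ball, dist_eq_norm] at hz
    obtain ⟨s1, hs1, hs1z, hs1R⟩ := hc (‖z - b‖ / 2) (by positivity) (by linarith)
    set U : Set ℂ := {w | s1 < ‖w - b‖ ∧ ‖w - b‖ < s0} with hU
    have hUo : IsOpen U := annulus_open _ _ _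
    have hcl : closure U ⊆ {w | s1 ≤ ‖w - b‖ ∧ ‖w - b‖ ≤ s0} :=
      closure_minimal (fun w hw => ⟨hw.1.le, hw.2.le⟩)
        (annulus_closed _ _ _)
    have hUb : Bornology.IsBounded U := (isBounded_ball (x := b) (r := s0)).subset fun w hw => by
      rw [mem_ball, dist_eq_norm]; exact hw.2
    have hd : DiffContOnCl ℂ f U := by
      apply DifferentiableOn.diffContOnCl
      refine hf.mono fun w hw => ⟨?_, ?_⟩
      · rw [mem_ball, dist_eq_norm]; linarith [(hcl hw).2]
      · rintro rfl
        have := (hcl hw).1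
        simp at this
        linarith
    refine Complex.norm_le_of_forall_mem_frontier_norm_le hUb hd ?_
      (subset_closure (show z ∈ U from ⟨by linarith, hz⟩))
    intro w hw
    rw [hUo.frontier_eq] at hw
    have h1 := hcl hw.1
    rcases h1.1.eq_or_lt with h | h
    · exact hs1R w h.symm
    · rcases h1.2.eq_or_lt with h' | h'
      · exact hs0R w h'
      · exact absurd ⟨h, h'⟩ hw.2
  refine hno s0 hs0 (by linarith) ⟨Function.update f b (limUnder (𝓝[≠] b) f), ?_, ?_⟩
  · refine Complex.differentiableOn_update_limUnder_of_bddAbove (ball_mem_nhds b hs0)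
      (hf.mono (sdiff_subset_sdiff_left (ball_subset_ball (by linarith)))) ⟨R, ?_⟩
    rintro _ ⟨w, hw, rfl⟩
    exact hbd w hw
  · intro w hw
    rw [Function.update_of_ne hw.2]

theorem type2 {D A : Set ℂ} {f : ℂ → ℂ} (hD : IsOpen D)
    (hAcl : ∀ z ∈ D, z ∈ closure A → z ∈ A) (hApol : PolarSet A)
    (hf : DifferentiableOn ℂ f (D \ A)) (j : ℕ) {ε : ℝ} (hε : 0 < ε) {b : ℂ}
    (hbA : b ∈ A) (hbD : b ∈ D) (hiso : b ∉ closure (A \ {b}))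
    (hnoext : ¬ ∃ (V : Set ℂ) (g : ℂ → ℂ), IsOpen V ∧ b ∈ V ∧ V ⊆ D ∧
      DifferentiableOn ℂ g V ∧ Set.EqOn f g (V \ A)) {r : ℝ} (hr : 0 < r)
    {L : Set (ℂ × ℂ)} (hL : IsCompact L) (hLO : ∀ p ∈ L, p.1 ∈ D \ A ∧ p.2 ≠ f p.1) :
    ∃ h : ℂ × ℂ → ℝ, (∀ p, p.1 ∈ D → Supp h p) ∧
      (∀ p, p.1 ∈ D → chi D p ≤ j → h p ≤ 0) ∧
      (∀ z ∈ D \ A, r ≤ ‖z - b‖ → chi D (z, f z) ≤ j → h (z, f z) ≤ -1) ∧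
      (∀ p, p.1 ∈ D → p.1 ∈ A → p.1 ≠ b → chi D p ≤ j → h p ≤ -1) ∧
      (∀ p, p.1 = b → chi D p ≤ j → -(2 * ε) ≤ h p) := by
  have hopen : IsOpen (D \ A) := isOpen_diff_of hD hAcl
  set R := Real.exp (j + 2) with hR
  obtain ⟨ρ1, hρ1, hDa⟩ := Metric.isOpen_iff.1 hD b hbD
  obtain ⟨ρ2, hρ2, hAb⟩ := Metric.isOpen_iff.1 (isClosed_closure (s := A \ {b})).isOpen_compl b hiso
  obtain ⟨r0, hr0, hr0r, hr01, hr02⟩ : ∃ r0 : ℝ, 0 < r0 ∧ r0 ≤ r ∧ r0 ≤ ρ1 ∧ r0 ≤ ρ2 :=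
    ⟨min r (min ρ1 ρ2), by positivity, by simp, by simp, by simp⟩
  have hfar : ∀ a ∈ A, a ≠ b → r0 ≤ ‖a - b‖ := by
    intro a ha hab
    by_contra hlt
    push Not at hlt
    refine hAb (show a ∈ ball b ρ2 from ?_) (subset_closure ⟨ha, hab⟩)
    rw [mem_ball, dist_eq_norm]; linarith
  have hpunc : ∀ z, 0 < ‖z - b‖ → ‖z - b‖ < r0 → z ∈ D \ A := by
    intro z h0 h1
    refine ⟨hDa ?_, fun hzA => ?_⟩
    · rw [mem_ball, dist_eq_norm]; linarith
    · have := hfar z hzA (fun h => by simp [h] at h0)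
      linarith
  obtain ⟨ρ0, hρ0, hrz, hbig⟩ := big_circles (f := f) (b := b) (R := R + 2) hr0
    (hf.mono fun z hz => hpunc z (norm_pos_iff.2 (sub_ne_zero.2 hz.2))
      (by rw [← dist_eq_norm]; exact hz.1)) (by
    rintro s hs hsr ⟨g, hg, hfg⟩
    refine hnoext ⟨ball b s, g, isOpen_ball, mem_ball_self hs,
      (ball_subset_ball (by linarith)).trans hDa, hg, hfg.mono ?_⟩
    exact sdiff_subset_sdiff_right (singleton_subset_iff.2 hbA))
  -- constants
  set C := Real.log 4 + 1 + Real.log 3 + Real.log 2 with hC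
  have hC0 : 0 < C := by
    have h4 : 0 < Real.log 4 := Real.log_pos (by norm_num)
    have h3 : 0 < Real.log 3 := Real.log_pos (by norm_num)
    have h2 : 0 < Real.log 2 := Real.log_pos (by norm_num)
    positivity
  obtain ⟨r1, hr1, hr1ρ, hr10, hr1Λ⟩ : ∃ r1 : ℝ, 0 < r1 ∧ r1 ≤ ρ0 ∧ 4 * r1 ≤ r0 ∧
      C / ε ≤ Real.log (r0 / 2) - Real.log r1 := by
    refine ⟨min (min ρ0 (r0 / 4)) (Real.exp (Real.log (r0 / 2) - C / ε)), by positivity, ?_, ?_, ?_⟩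
    · exact (min_le_left _ _).trans (min_le_left _ _)
    · have := (min_le_left (min ρ0 (r0 / 4))
        (Real.exp (Real.log (r0 / 2) - C / ε))).trans (min_le_right _ _)
      linarith
    · have := Real.log_le_log (by positivity) (min_le_right (min ρ0 (r0 / 4))
        (Real.exp (Real.log (r0 / 2) - C / ε)))
      rw [Real.log_exp] at this
      linarith
  set Λ := Real.log (r0 / 2) - Real.log r1 + C with hΛ
  have hΛ0 : 0 < Λ := by have : 0 < C / ε := by positivity
                         linarith
  have hCΛ : C / Λ ≤ ε := by
    rw [div_le_iff₀ hΛ0]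
    rw [div_le_iff₀ hε] at hr1Λ
    nlinarith
  -- the compact set
  set T : Set ℂ := {z | r1 / 2 ≤ ‖z - b‖ ∧ ‖z - b‖ ≤ r1} with hT
  have hTc : IsCompact T := by
    refine isCompact_of_isClosed_isBounded (annulus_closed _ _ _) ((isBounded_closedBall (x := b) (r := r1)).subset ?_)
    intro z hz
    rw [mem_closedBall, dist_eq_norm]; exact hz.2
  have hTD : T ⊆ D \ A := fun z hz => hpunc z (by linarith [hz.1]) (by linarith [hz.2])
  set K : Set ℂ := T ∩ {z | R + 2 ≤ ‖f z‖} with hK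
  have hKc : IsCompact K := by
    have : IsClosed (T ∩ (fun z => ‖f z‖) ⁻¹' (Ici (R + 2))) :=
      ((hf.continuousOn.mono hTD).norm).preimage_isClosed_of_isClosed hTc.isClosed isClosed_Ici
    exact hTc.of_isClosed_subset this inter_subset_left
  have hKne : K.Nonempty := by
    obtain ⟨z, hz, hz'⟩ := hbig r1 hr1 hr1ρ
    exact ⟨z, ⟨by linarith, by linarith⟩, hz'⟩
  set W : Set ℂ := {z | r1 / 4 < ‖z - b‖ ∧ ‖z - b‖ < 2 * r1} with hW
  have hWo : IsOpen W := annulus_open _ _ _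
  have hWD : W ⊆ D \ A := fun z hz => hpunc z (by linarith [hz.1]) (by linarith [hz.2])
  set O : Set ℂ := W ∩ {z | R + 1 < ‖f z‖} with hO
  have hOo : IsOpen O := by
    have : IsOpen (W ∩ (fun z => ‖f z‖) ⁻¹' (Ioi (R + 1))) :=
      ((hf.continuousOn.mono hWD).norm).isOpen_inter_preimage hWo isOpen_Ioi
    exact this
  have hKO : K ⊆ O := fun z hz => ⟨⟨by linarith [hz.1.1], by linarith [hz.1.2]⟩, by
    have : R + 2 ≤ ‖f z‖ := hz.2
    show R + 1 < ‖f z‖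
    linarith⟩
  obtain ⟨δ0, hδ0, hδ0O⟩ := hKc.exists_cthickening_subset_open hOo hKO
  obtain ⟨δ, hδ, hδ1, hδ2⟩ : ∃ δ : ℝ, 0 < δ ∧ δ ≤ δ0 ∧ δ ≤ r1 :=
    ⟨min δ0 r1, by positivity, by simp, by simp⟩
  have hZO : cthickening δ K ⊆ O := (cthickening_mono hδ1 K).trans hδ0O
  obtain ⟨t, c, q, htK, hc0, hc1, hlow, hup⟩ := equilibrium hKc hKne hδ
  have htT : ∀ w ∈ t, r1 / 2 ≤ ‖w - b‖ ∧ ‖w - b‖ ≤ r1 := fun w hw => (htK hw).1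
  have hproj := proj_est (Q := q + Real.log 3) hr1 hδ htT hc0 hc1 (by
    intro s h1 h2
    obtain ⟨z, hz, hz'⟩ := hbig s (by linarith) (by linarith)
    exact ⟨z, hz, hup z ⟨z, ⟨⟨by linarith, by linarith⟩, hz'⟩, by simp [hδ.le]⟩⟩)
  have hpot : ∀ z, Real.log r1 - C ≤ pot t c δ z := fun z => by
    have := hlow z
    linarith
  set β : ℂ → ℝ := fun z => (Real.log r1 - pot t c δ z - C) / Λ - ε with hβ
  have hβε : ∀ z, β z ≤ -ε := fun z => by
    have : (Real.log r1 - pot t c δ z - C) / Λ ≤ 0 :=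
      div_nonpos_of_nonpos_of_nonneg (by linarith [hpot z]) hΛ0.le
    simp only [hβ]; linarith
  have hβcont : Continuous β := by
    have := pot_continuous (t := t) (c := c) hδ
    simp only [hβ]
    fun_prop
  have hβsupp : ∀ z, z ∉ cthickening δ K → Supp β z := by
    intro z hz
    have h1 : Supp (fun z => (-(1 / Λ)) * pot t c δ z) z := by
      refine pot_supp hδ _ fun w hw => ?_
      by_contra hle
      push Not at hle
      exact hz (mem_cthickening_of_dist_le z w δ K (htK hw) (by rw [dist_eq_norm]; exact hle))
    refine (h1.add (supp_const ((Real.log r1 - C) / Λ - ε) z)).congr (Eventually.of_forall fun y => ?_)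
    simp only [hβ]
    field_simp
    ring
  have hβfar : ∀ z, r0 ≤ ‖z - b‖ → β z ≤ -1 := by
    intro z hz
    have h1 : Real.log (r0 / 2) ≤ pot t c δ z := by
      refine pot_ge (by positivity) hc0 hc1 fun w hw => le_max_of_le_left ?_
      have h2 := norm_sub_norm_le (z - b) (w - b)
      rw [sub_sub_sub_cancel_right] at h2
      linarith [(htT w hw).2]
    have h2 : (Real.log r1 - pot t c δ z - C) / Λ ≤ -1 := by
      rw [div_le_iff₀ hΛ0]; linarith
    simp only [hβ]; linarith
  have hβb : -(2 * ε) ≤ β b := by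
    have h1 : pot t c δ b ≤ Real.log r1 := by
      refine pot_le hδ hc0 hc1 fun w hw => max_le ?_ hδ2
      rw [norm_sub_rev]; exact (htT w hw).2
    have h2 : -(C / Λ) ≤ (Real.log r1 - pot t c δ b - C) / Λ := by
      rw [← neg_div]; exact div_le_div_of_nonneg_right (by linarith) hΛ0.le
    simp only [hβ]; linarith
  obtain ⟨M, hM⟩ := ((psi_compact hD ((j : ℝ) + 2)).image hβcont).bddBelow
  obtain ⟨h, h1, h2, h3, h4, h5⟩ := glue hD hAcl hApol hf j hε (b := |M| + 1) (d0 := r1 / 4)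
    (by positivity) (by positivity) β (cthickening δ K) O isClosed_cthickening hOo hZO
    (inter_subset_left.trans hWD) (fun z hz => le_of_lt hz.2) (by
      intro z hz a ha
      rcases eq_or_ne a b with rfl | hab
      · rw [dist_eq_norm]; exact hz.1.1.le
      · have ha' := hfar a ha hab
        have h2 := norm_sub_norm_le (a - b) (z - b)
        rw [sub_sub_sub_cancel_right, norm_sub_rev] at h2
        rw [dist_eq_norm, norm_sub_rev]
        rw [norm_sub_rev b a] at h2
        have := hz.1.2
        linarith) hβsupp (fun z _ _ _ => hβε z) (fun z hz hz' => by
      have := hM (mem_image_of_mem β (show z ∈ {z | z ∈ D ∧ psi D z ≤ (j : ℝ) + 2} from ⟨hz, hz'⟩))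
      linarith [neg_abs_le M]) hL hLO
  refine ⟨h, h1, h2, ?_, ?_, ?_⟩
  · intro z hz hzr hch
    exact (h3 z hz hch).trans (max_le le_rfl (hβfar z (by linarith)))
  · intro p hp hpA hpb hch
    exact (h4 p hp hpA hch).1.trans (max_le le_rfl (hβfar _ (hfar _ hpA hpb)))
  · intro p hp hch
    have := (h4 p (hp ▸ hbD) (hp ▸ hbA) hch).2
    rw [hp] at this
    linarith

theorem countable_iso {A B : Set ℂ} (hBA : B ⊆ A) (hBiso : ∀ b ∈ B, b ∉ closure (A \ {b})) :
    B.Countable := by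
  have : DiscreteTopology B := by
    rw [discreteTopology_subtype_iff]
    intro x hx
    rw [nhdsWithin, inf_assoc, inf_principal, ← nhdsWithin]
    by_contra hne
    have : (𝓝[{x}ᶜ ∩ B] x).NeBot := ⟨hne⟩
    refine hBiso x hx (closure_mono ?_ (mem_closure_iff_nhdsWithin_neBot.2 this))
    exact fun y hy => ⟨hBA hy.2, hy.1⟩
  have h2 : Countable B := countable_of_Lindelof_of_discrete
  exact countable_coe_iff.1 h2

theorem level {D A B : Set ℂ} {f : ℂ → ℂ} (hD : IsOpen D) (hAD : A ⊆ D)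
    (hAcl : ∀ z ∈ D, z ∈ closure A → z ∈ A) (hApol : PolarSet A)
    (hf : DifferentiableOn ℂ f (D \ A))
    (hBA : B ⊆ A) (hBiso : ∀ b ∈ B, b ∉ closure (A \ {b}))
    (hnoext : ∀ b ∈ B, ¬ ∃ (V : Set ℂ) (g : ℂ → ℂ), IsOpen V ∧ b ∈ V ∧ V ⊆ D ∧
      DifferentiableOn ℂ g V ∧ Set.EqOn f g (V \ A))
    (e : ℂ → ℕ) (he : InjOn e B) (j : ℕ) {ε r : ℝ} (hε : 0 < ε) (hε1 : ε ≤ 1) (hr : 0 < r)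
    {L : Set (ℂ × ℂ)} (hL : IsCompact L) (hLO : ∀ p ∈ L, p.1 ∈ D \ A ∧ p.2 ≠ f p.1) (n : ℕ) :
    ∃ h : ℂ × ℂ → ℝ, (∀ p, p.1 ∈ D → Supp h p) ∧
      (∀ p, p.1 ∈ D → chi D p ≤ j → h p ≤ 0) ∧
      (∀ z ∈ D \ A, (∀ b ∈ B, r ≤ ‖z - b‖) → chi D (z, f z) ≤ j → h (z, f z) ≤ -1) ∧
      (∀ p, p.1 ∈ D → p.1 ∈ A \ B → chi D p ≤ j → h p ≤ -1) ∧
      (∀ p ∈ L, chi D p ≤ j → -ε ≤ h p) ∧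
      (∀ p, p.1 ∈ B → e p.1 < n → chi D p ≤ j → -(2 * ε) ≤ h p) := by
  induction n with
  | zero =>
    obtain ⟨h, h1, h2, h3, h4, h5⟩ := glue hD hAcl hApol hf j hε (b := 1) (d0 := 1) one_pos one_pos
      (fun _ => -1) ∅ ∅ isClosed_empty isOpen_empty subset_rfl (empty_subset _) (by simp) (by simp)
      (fun z _ => supp_const _ z) (fun _ _ _ _ => by linarith) (fun _ _ _ => le_rfl) hL hLO
    refine ⟨h, h1, h2, ?_, ?_, h5, ?_⟩
    · intro z hz _ hc
      simpa using h3 z hz hc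
    · intro p hp hpA hc
      simpa using (h4 p hp hpA.1 hc).1
    · intro p _ h0
      exact absurd h0 (Nat.not_lt_zero _)
  | succ n ih =>
    obtain ⟨h, h1, h2, h3, h4, h5, h6⟩ := ih
    by_cases hb : ∃ b ∈ B, e b = n
    · obtain ⟨b, hbB, hbn⟩ := hb
      obtain ⟨g, g1, g2, g3, g4, g5⟩ := type2 hD hAcl hApol hf j hε (hBA hbB) (hAD (hBA hbB))
        (hBiso b hbB) (hnoext b hbB) hr hL hLO
      refine ⟨fun p => max (h p) (g p), fun p hp => (h1 p hp).max (g1 p hp), ?_, ?_, ?_, ?_, ?_⟩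
      · exact fun p hp hc => max_le (h2 p hp hc) (g2 p hp hc)
      · exact fun z hz hzb hc => max_le (h3 z hz hzb hc) (g3 z hz (hzb b hbB) hc)
      · exact fun p hp hpA hc => max_le (h4 p hp hpA hc)
          (g4 p hp hpA.1 (fun hpb => hpA.2 (hpb ▸ hbB)) hc)
      · exact fun p hp hc => le_max_of_le_left (h5 p hp hc)
      · intro p hp hpn hc
        rcases Nat.lt_succ_iff_lt_or_eq.1 hpn with hlt | heq
        · exact le_max_of_le_left (h6 p hp hlt hc)
        · exact le_max_of_le_right (g5 p (he hp hbB (heq.trans hbn.symm)) hc)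
    · refine ⟨h, h1, h2, h3, h4, h5, ?_⟩
      intro p hp hpn hc
      rcases Nat.lt_succ_iff_lt_or_eq.1 hpn with hlt | heq
      · exact h6 p hp hlt hc
      · exact absurd ⟨p.1, hp, heq⟩ hb

/-- Let `A` be closed polar in a domain `D ⊆ ℂ`, `f` holomorphic on
`D \ A`, and `B ⊆ A` a set of points isolated in `A` at which `f` does not extend
holomorphically. Then `Γ_f ∪ ((A \ B) × ℂ)` is complete pluripolar in `D × ℂ`. -/
theorem statement16 (D A B : Set ℂ) (f : ℂ → ℂ)
    (hD : IsOpen D) (hDconn : IsConnected D)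
    (hAD : A ⊆ D) (hAclosed : ∀ z ∈ D, z ∈ closure A → z ∈ A)
    (hApolar : PolarSet A)
    (hf : DifferentiableOn ℂ f (D \ A))
    (hBA : B ⊆ A) (hBiso : ∀ b ∈ B, b ∉ closure (A \ {b}))
    (hnoext : ∀ b ∈ B, ¬ ∃ (V : Set ℂ) (g : ℂ → ℂ), IsOpen V ∧ b ∈ V ∧ V ⊆ D ∧
      DifferentiableOn ℂ g V ∧ Set.EqOn f g (V \ A)) :
    CompletePluripolarIn (graphOver f (D \ A) ∪ (A \ B) ×ˢ (Set.univ : Set ℂ))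
      (D ×ˢ (Set.univ : Set ℂ)) := by
  have hopen : IsOpen (D \ A) := isOpen_diff_of hD hAclosed
  obtain ⟨e, he⟩ := countable_iff_exists_injOn.1 (countable_iso hBA hBiso)
  set U : Set (ℂ × ℂ) := {p | p.1 ∈ D \ A ∧ p.2 ≠ f p.1} with hU
  have hUo : IsOpen U := by
    have h1 : IsOpen ((D \ A) ×ˢ (univ : Set ℂ)) := hopen.prod isOpen_univ
    have h2 : ContinuousOn (fun p : ℂ × ℂ => p.2 - f p.1) ((D \ A) ×ˢ (univ : Set ℂ)) :=
      continuousOn_snd.sub (hf.continuousOn.comp continuousOn_fst fun p hp => hp.1)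
    have h3 := h2.isOpen_inter_preimage h1 (isOpen_compl_singleton (x := (0 : ℂ)))
    convert h3 using 1
    ext p
    simp [hU, sub_eq_zero]
  obtain ⟨F, hFcl, hFU, hFun, hFm⟩ := hUo.exists_iUnion_isClosed
  have hLc : ∀ j : ℕ, IsCompact (F j ∩ closedBall 0 (j : ℝ)) := fun j =>
    (isCompact_closedBall _ _).inter_left (hFcl j)
  have hε : ∀ j : ℕ, (0 : ℝ) < (1 / 2) ^ j / 2 := fun j => by positivity
  have hε1 : ∀ j : ℕ, ((1 : ℝ) / 2) ^ j / 2 ≤ 1 := fun j => by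
    have : ((1 : ℝ) / 2) ^ j ≤ 1 := pow_le_one₀ (by norm_num) (by norm_num)
    linarith
  have hlev := fun j : ℕ => level hD hAD hAclosed hApolar hf hBA hBiso hnoext e he j (hε j) (hε1 j)
    (r := 1 / ((j : ℝ) + 1)) (by positivity) (hLc j) (fun p hp => hFU j hp.1) j
  choose h h1 h2 h3 h4 h5 h6 using hlev
  have hchi : ∀ p : ℂ × ℂ, p.1 ∈ D → ∀ᶠ j : ℕ in atTop, chi D p ≤ j := fun p _ =>
    (eventually_ge_atTop ⌈chi D p⌉₊).mono fun j hj => Nat.ceil_le.1 hj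
  refine sum_psh (h := h) (hD.prod isOpen_univ) (hDconn.isPreconnected.prod isPreconnected_univ)
    (fun j p hp => h1 j p hp.1) ?_ ?_ ?_ ?_
  · intro K hK hKc
    obtain ⟨J, hJ⟩ := chi_bdd hD hKc fun p hp => (hK hp).1
    exact ⟨J, fun j hj p hp => h2 j p (hK hp).1 (hJ j hj p hp)⟩
  · rintro ⟨z, w⟩ hp hpS
    rcases hpS with ⟨hz, hw⟩ | ⟨hz, -⟩
    · simp only at hz hw
      subst hw
      obtain ⟨η, hη, hηD⟩ := Metric.isOpen_iff.1 hopen z hz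
      have hev : ∀ᶠ j : ℕ in atTop, 1 / ((j : ℝ) + 1) < η :=
        tendsto_one_div_add_atTop_nhds_zero_nat.eventually (gt_mem_nhds hη)
      filter_upwards [hev, hchi (z, f z) hz.1] with j hj hc
      refine h3 j z hz (fun b hb => ?_) hc
      by_contra hlt
      push Not at hlt
      refine (hηD (show b ∈ ball z η from ?_)).2 (hBA hb)
      rw [mem_ball, dist_eq_norm, norm_sub_rev]; linarith
    · filter_upwards [hchi (z, w) hp.1] with j hc
      exact h4 j (z, w) hp.1 hz hc
  · rintro p hp hpS
    by_cases hpA : p.1 ∈ A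
    · have hpB : p.1 ∈ B := by
        by_contra hB
        exact hpS (Or.inr ⟨⟨hpA, hB⟩, mem_univ _⟩)
      filter_upwards [hchi p hp.1, eventually_gt_atTop (e p.1)] with j hc hj
      have := h6 j p hpB hj hc
      linarith
    · have hpU : p ∈ U := ⟨⟨hp.1, hpA⟩, fun hw => hpS (Or.inl ⟨⟨hp.1, hpA⟩, hw⟩)⟩
      rw [← hFun] at hpU
      obtain ⟨i, hi⟩ := mem_iUnion.1 hpU
      filter_upwards [hchi p hp.1, eventually_ge_atTop i, eventually_ge_atTop ⌈‖p‖⌉₊]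
        with j hc hj hj'
      have := h5 j p ⟨hFm hj hi, by simpa using Nat.ceil_le.1 hj'⟩ hc
      linarith [hε j]
  · obtain ⟨z, hz⟩ := hDconn.nonempty
    obtain ⟨ρ, hρ, hρD⟩ := Metric.isOpen_iff.1 hD z hz
    have hnb := polar_not_ball (b := z) hApolar (half_pos hρ)
    obtain ⟨y, hy, hyA⟩ := not_subset.1 hnb
    have hyD : y ∈ D := hρD (closedBall_subset_ball (by linarith) hy)
    refine ⟨(y, f y + 1), ⟨hyD, mem_univ _⟩, ?_⟩
    rintro (⟨-, h0⟩ | ⟨h0, -⟩)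
    · simp at h0
    · exact hyA h0.1
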